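/- Let G be a candidate and let C be a shortest long even hole in G such that for some C-major vertex x there is a (C,x)-gap. Then there exists a C-contrivance with cost at most 4ℓ−4. -/

import Mathlib

open SimpleGraph

namespace LEH

open scoped Classical

variable {V : Type*}

/-- `X` is anticomplete to `Y`: they are disjoint and there are no edges between them. -/
def Anticomplete (G : SimpleGraph V) (X Y : Set V) : Prop :=
  ∀ ⦃x⦄, x ∈ X → ∀ ⦃y⦄, y ∈ Y → x ≠ y ∧ ¬ G.Adj x y

/-- The vertex set of a walk. -/
def vset {G : SimpleGraph V} {u v : V} (P : G.Walk u v) : Set V :=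
  {x | x ∈ P.support}

/-- The interior of a path: its non-end vertices. -/
def inter {G : SimpleGraph V} {u v : V} (P : G.Walk u v) : Set V :=
  {x | x ∈ P.support ∧ x ≠ u ∧ x ≠ v}

/-- An induced path in `G`. -/
def IsInducedPath {G : SimpleGraph V} {u v : V} (P : G.Walk u v) : Prop :=
  P.IsPath ∧ ∀ x ∈ P.support, ∀ y ∈ P.support, G.Adj x y → s(x, y) ∈ P.edges

/-- A hole: an induced cycle of length at least 4. -/
def IsHole {G : SimpleGraph V} {u : V} (c : G.Walk u u) : Prop :=
  c.IsCycle ∧ 4 ≤ c.length ∧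
    ∀ x ∈ c.support, ∀ y ∈ c.support, G.Adj x y → s(x, y) ∈ c.edges

/-- A long even hole: a hole of even length at least `ℓ`. -/
def IsLongEvenHole (ℓ : ℕ) {G : SimpleGraph V} {u : V} (c : G.Walk u u) : Prop :=
  IsHole c ∧ ℓ ≤ c.length ∧ Even c.length

def HasLongEvenHole (G : SimpleGraph V) (ℓ : ℕ) : Prop :=
  ∃ (u : V) (c : G.Walk u u), IsLongEvenHole ℓ c

/-- A long theta in `G`: two nonadjacent vertices joined by three internally disjoint
induced paths with no edges between their interiors, any two of which form a long hole. -/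
def HasLongTheta (G : SimpleGraph V) (ℓ : ℕ) : Prop :=
  ∃ (u v : V) (P₁ P₂ P₃ : G.Walk u v),
    u ≠ v ∧ ¬ G.Adj u v ∧
    IsInducedPath P₁ ∧ IsInducedPath P₂ ∧ IsInducedPath P₃ ∧
    Anticomplete G (inter P₁) (inter P₂) ∧
    Anticomplete G (inter P₁) (inter P₃) ∧
    Anticomplete G (inter P₂) (inter P₃) ∧
    ℓ ≤ P₁.length + P₂.length ∧ ℓ ≤ P₁.length + P₃.length ∧
    ℓ ≤ P₂.length + P₃.length

/-- A long jewel of order `k` formed by `Q₁, Q₂, P`. -/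
def IsLongJewel (ℓ k : ℕ) {G : SimpleGraph V} {u v : V}
    (Q₁ Q₂ P : G.Walk u v) : Prop :=
  u ≠ v ∧
  IsInducedPath Q₁ ∧ IsInducedPath Q₂ ∧ IsInducedPath P ∧
  ¬ (Even Q₁.length ↔ Even Q₂.length) ∧
  max Q₁.support.length Q₂.support.length = k ∧
  ℓ ≤ P.length + min Q₁.length Q₂.length ∧
  Anticomplete G (inter P) (inter Q₁ ∪ inter Q₂)

def HasLongJewel (G : SimpleGraph V) (ℓ k : ℕ) : Prop :=
  ∃ (u v : V) (Q₁ Q₂ P : G.Walk u v), IsLongJewel ℓ k Q₁ Q₂ P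

/-- A long ban-the-bomb in `G`. -/
def IsLongBanTheBomb (ℓ : ℕ) {G : SimpleGraph V} (u v₁ w v₂ x : V)
    (P₁ : G.Walk x v₁) (P₂ : G.Walk x v₂) : Prop :=
  G.Adj u v₁ ∧ G.Adj v₁ w ∧ G.Adj w v₂ ∧ G.Adj v₂ u ∧ ¬ G.Adj v₁ v₂ ∧ u ≠ w ∧
  G.Adj x u ∧ ¬ G.Adj x v₁ ∧ ¬ G.Adj x v₂ ∧ ¬ G.Adj x w ∧
  x ≠ v₁ ∧ x ≠ v₂ ∧ x ≠ w ∧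
  IsInducedPath P₁ ∧ IsInducedPath P₂ ∧
  2 ≤ P₁.length ∧ 2 ≤ P₂.length ∧
  Anticomplete G (inter P₁) {u, w} ∧ Anticomplete G (inter P₂) {u, w} ∧
  Anticomplete G (vset P₁ \ {x}) (vset P₂ \ {x}) ∧
  ℓ ≤ P₁.length + 2 ∧ ℓ ≤ P₂.length + 2 ∧ ℓ ≤ P₁.length + P₂.length + 2

def HasLongBanTheBomb (G : SimpleGraph V) (ℓ : ℕ) : Prop :=
  ∃ (u v₁ w v₂ x : V) (P₁ : G.Walk x v₁) (P₂ : G.Walk x v₂),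
    IsLongBanTheBomb ℓ u v₁ w v₂ x P₁ P₂

/-- The induced subgraph of `G` on the vertex set `S` is a long hole. -/
def IsLongHoleOn (G : SimpleGraph V) (ℓ : ℕ) (S : Set V) : Prop :=
  ∃ (u : V) (c : G.Walk u u), IsHole c ∧ ℓ ≤ c.length ∧ {x | x ∈ c.support} = S

/-- A long near-prism with triangles `{a 0, a 1, a 2}`, `{b 0, b 1, b 2}` and
constituent paths `P 0, P 1, P 2`. -/
def IsLongNearPrism (ℓ : ℕ) {G : SimpleGraph V} (a b : Fin 3 → V)
    (P : ∀ i : Fin 3, G.Walk (a i) (b i)) : Prop :=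
  (∀ i j, i ≠ j → G.Adj (a i) (a j)) ∧
  (∀ i j, i ≠ j → G.Adj (b i) (b j)) ∧
  (Set.range a ∩ Set.range b).Subsingleton ∧
  (∀ i, (P i).IsPath) ∧
  (∀ i j, i ≠ j → ∀ x, x ∈ (P i).support → x ∉ (P j).support) ∧
  (∀ i j, i ≠ j → IsLongHoleOn G ℓ (vset (P i) ∪ vset (P j)))

def HasLongNearPrism (G : SimpleGraph V) (ℓ : ℕ) : Prop :=
  ∃ (a b : Fin 3 → V) (P : ∀ i : Fin 3, G.Walk (a i) (b i)), IsLongNearPrism ℓ a b P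

/-- A prospect: no long even hole of length at most `2ℓ`, no long jewel of order at most
`ℓ+1`, no long theta and no long ban-the-bomb. -/
def Prospect (G : SimpleGraph V) (ℓ : ℕ) : Prop :=
  (¬ ∃ (u : V) (c : G.Walk u u), IsLongEvenHole ℓ c ∧ c.length ≤ 2 * ℓ) ∧
  (¬ ∃ k ≤ ℓ + 1, HasLongJewel G ℓ k) ∧
  ¬ HasLongTheta G ℓ ∧ ¬ HasLongBanTheBomb G ℓ

/-- A candidate : a prospect with no long near-prism. -/
def Candidate (G : SimpleGraph V) (ℓ : ℕ) : Prop :=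
  Prospect G ℓ ∧ ¬ HasLongNearPrism G ℓ

/-- The vertex set of a near-prism. -/
def prismSupport {G : SimpleGraph V} {a b : Fin 3 → V}
    (P : ∀ i : Fin 3, G.Walk (a i) (b i)) : Set V :=
  ⋃ i, vset (P i)

/-- The near-prism, as a graph on `V`. -/
def prismGraph (G : SimpleGraph V) (a b : Fin 3 → V)
    (P : ∀ i : Fin 3, G.Walk (a i) (b i)) : SimpleGraph V :=
  SimpleGraph.fromEdgeSet
    ({e | ∃ i j, i ≠ j ∧ e = s(a i, a j)} ∪ {e | ∃ i j, i ≠ j ∧ e = s(b i, b j)} ∪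
      {e | ∃ i, e ∈ (P i).edges})

/-- `q` is `K`-major: `q` is outside the near-prism `K`, and no path of `K` with at most
three vertices contains all neighbours of `q` in `V(K)`. -/
def KMajor (G : SimpleGraph V) {a b : Fin 3 → V}
    (P : ∀ i : Fin 3, G.Walk (a i) (b i)) (q : V) : Prop :=
  q ∉ prismSupport P ∧
  ¬ ∃ (x y : V) (W : (prismGraph G a b P).Walk x y), W.IsPath ∧ W.length ≤ 2 ∧
      ∀ z ∈ prismSupport P, G.Adj q z → z ∈ W.support

/-- A shortest long near-prism. -/
def ShortestLNP (G : SimpleGraph V) (ℓ : ℕ) {a b : Fin 3 → V}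
    (P : ∀ i : Fin 3, G.Walk (a i) (b i)) : Prop :=
  IsLongNearPrism ℓ a b P ∧
  ∀ (a' b' : Fin 3 → V) (P' : ∀ i : Fin 3, G.Walk (a' i) (b' i)),
    IsLongNearPrism ℓ a' b' P' → (prismSupport P).ncard ≤ (prismSupport P').ncard

/-- The interior `F_K*` of the frame of a long near-prism: for each constituent path,
either the whole path (if it has length at most `ℓ-1`), or the non-end vertices of the
two stubs of length `ℓ/2 - 1` at its two ends. -/
def frameStar (ℓ : ℕ) {G : SimpleGraph V} {a b : Fin 3 → V}
    (P : ∀ i : Fin 3, G.Walk (a i) (b i)) : Set V :=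
  ⋃ i,
    if (P i).length ≤ ℓ - 1 then vset (P i)
    else {x | x ∈ (P i).support.take (ℓ / 2 - 1)} ∪
      {x | x ∈ (P i).support.reverse.take (ℓ / 2 - 1)}

/-- A long near-prism is tidy: it contains a frame (so at most one constituent path has
length at most `ℓ-1`) whose interior is anticomplete to the rest of the graph. -/
def Tidy (G : SimpleGraph V) (ℓ : ℕ) {a b : Fin 3 → V}
    (P : ∀ i : Fin 3, G.Walk (a i) (b i)) : Prop :=
  (∀ i j, (P i).length ≤ ℓ - 1 → (P j).length ≤ ℓ - 1 → i = j) ∧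
  Anticomplete G (frameStar ℓ P) {x | x ∉ prismSupport P}

/-- The index of the first neighbour of `x` in the list `l`. -/
noncomputable def firstNbrIdx (G : SimpleGraph V) (l : List V) (x : V) : ℕ :=
  l.findIdx (fun y => decide (G.Adj x y))

/-- `α(x)`: the neighbour of `x` on `P` nearest to the first end of `P`. -/
noncomputable def alpha (G : SimpleGraph V) {u w : V} (P : G.Walk u w) (x : V) : V :=
  P.support.getD (firstNbrIdx G P.support x) u

/-- `β(x)`: the neighbour of `x` on `P` nearest to the last end of `P`. -/
noncomputable def beta (G : SimpleGraph V) {u w : V} (P : G.Walk u w) (x : V) : V :=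
  P.support.reverse.getD (firstNbrIdx G P.support.reverse x) w

/-- `A(x)`: the vertex set of the subpath of `P` from its first end to `α(x)` if `x` has
a neighbour on `P`, and all of `V(P)` otherwise. -/
noncomputable def Aset (G : SimpleGraph V) {u w : V} (P : G.Walk u w) (x : V) : Set V :=
  if ∃ y ∈ P.support, G.Adj x y then
    {z | z ∈ P.support.take (firstNbrIdx G P.support x + 1)}
  else vset P

noncomputable def A123 (G : SimpleGraph V) {a b : Fin 3 → V}
    (P : ∀ i : Fin 3, G.Walk (a i) (b i)) (x : V) : Set V :=
  ⋃ i, Aset G (P i) x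

/-- The index of `v` in the list `l`. -/
noncomputable def listIdx (l : List V) (v : V) : ℕ :=
  l.findIdx (fun z => decide (z = v))

/-- `K^m_n(v)`: the union of the maximal subpath of `P` from `v` towards the first end of
`P` of length at most `m` with no internal vertex in `Fs`, and the maximal subpath of `P`
from `v` towards the last end of `P` of length at most `n` with no internal vertex in `Fs`. -/
noncomputable def Kmn (G : SimpleGraph V) (Fs : Set V) {u w : V}
    (P : G.Walk u w) (v : V) (m n : ℕ) : Set V :=
  let t := listIdx P.support v
  {z | ∃ r, r ≤ t ∧ t - r ≤ m ∧
      (∀ q, r < q → q < t → P.support.getD q v ∉ Fs) ∧ z = P.support.getD r v} ∪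
  {z | ∃ r, t ≤ r ∧ r < P.support.length ∧ r - t ≤ n ∧
      (∀ q, t < q → q < r → P.support.getD q v ∉ Fs) ∧ z = P.support.getD r v}

/-- `y` is distant from `x` (both `K`-major), for a tidy near-prism. -/
def Distant (G : SimpleGraph V) (ℓ : ℕ) {a b : Fin 3 → V}
    (P : ∀ i : Fin 3, G.Walk (a i) (b i)) (x y : V) : Prop :=
  ¬ G.Adj x y ∧
  (∃ z ∈ A123 G P x, G.Adj y z) ∧
  (∀ i, (∃ z ∈ (P i).support, G.Adj x z) →
    ∀ z ∈ Kmn G (frameStar ℓ P) (P i) (alpha G (P i) x) (ℓ - 2) 1, ¬ G.Adj y z) ∧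
  (∀ i, (¬ ∃ z ∈ (P i).support, G.Adj x z) →
    ∃ j, j ≠ i ∧
      ∀ z ∈ Kmn G (frameStar ℓ P) (P j) (beta G (P j) x) 0 (ℓ - 3), ¬ G.Adj y z)

/-- The hole `c`, regarded as a graph on `V`. -/
def holeGraph (G : SimpleGraph V) {u : V} (c : G.Walk u u) : SimpleGraph V :=
  SimpleGraph.fromEdgeSet {e | e ∈ c.edges}

/-- The distance between two vertices in the hole `c`. -/
noncomputable def holeDist (G : SimpleGraph V) {u : V} (c : G.Walk u u) (x y : V) : ℕ :=
  (holeGraph G c).dist x y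

/-- `x` is `C`-major for the hole `c`: `x` is not on `c` and no path of `c` with at most
three vertices contains all neighbours of `x` on `c`. -/
def CMajor (G : SimpleGraph V) {u : V} (c : G.Walk u u) (x : V) : Prop :=
  x ∉ c.support ∧
  ¬ ∃ q ∈ c.support, ∀ z ∈ c.support, G.Adj x z → z = q ∨ s(q, z) ∈ c.edges

/-- A shortest long even hole. -/
def ShortestLEH (G : SimpleGraph V) (ℓ : ℕ) {u : V} (c : G.Walk u u) : Prop :=
  IsLongEvenHole ℓ c ∧
  ∀ (v : V) (c' : G.Walk v v), IsLongEvenHole ℓ c' → c.length ≤ c'.length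

/-- `L₁, L₂` are the two `x y`-paths of the hole `c`. -/
def ArcPair {G : SimpleGraph V} {u : V} (c : G.Walk u u) {x y : V}
    (L₁ L₂ : G.Walk x y) : Prop :=
  L₁.IsPath ∧ L₂.IsPath ∧
  (∀ e ∈ L₁.edges, e ∈ c.edges) ∧ (∀ e ∈ L₂.edges, e ∈ c.edges) ∧
  (∀ e ∈ c.edges, e ∈ L₁.edges ∨ e ∈ L₂.edges) ∧
  (∀ e ∈ L₁.edges, e ∉ L₂.edges)

/-- `X` is lighter than `Y`, with respect to the linear order on edges given by `idx`. -/
def Lighter [DecidableEq V] (idx : Sym2 V → ℕ) (X Y : Finset (Sym2 V)) : Prop :=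
  X.card < Y.card ∨
  (X.card = Y.card ∧ ∃ e ∈ Y, e ∉ X ∧
    ∀ f : Sym2 V, ((f ∈ X ∧ f ∉ Y) ∨ (f ∈ Y ∧ f ∉ X)) → idx e ≤ idx f)

/-- The lightest long even hole. -/
def LightestLEH [DecidableEq V] (G : SimpleGraph V) (ℓ : ℕ) (idx : Sym2 V → ℕ)
    {u : V} (c : G.Walk u u) : Prop :=
  IsLongEvenHole ℓ c ∧
  ∀ (v : V) (c' : G.Walk v v), IsLongEvenHole ℓ c' →
    c'.edges.toFinset ≠ c.edges.toFinset →
    Lighter idx c.edges.toFinset c'.edges.toFinset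

/-- A `(C,x)`-gap: a path of the hole `c` of length at least two whose ends are adjacent
to `x` and none of whose interior vertices is adjacent to `x`. -/
def IsGap (G : SimpleGraph V) {u : V} (c : G.Walk u u) (x : V) {p₁ p₂ : V}
    (P : G.Walk p₁ p₂) : Prop :=
  P.IsPath ∧ (∀ e ∈ P.edges, e ∈ c.edges) ∧ 2 ≤ P.length ∧
  G.Adj x p₁ ∧ G.Adj x p₂ ∧ ∀ z ∈ inter P, ¬ G.Adj x z

end LEH

open LEH

namespace LEH

/-- The walk traced out by a sequence of successively adjacent vertices. -/
theorem exists_walk_of_fun {V : Type*} {G : SimpleGraph V} (p : ℕ → V) (a : ℕ)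
    (h : ∀ k < a, G.Adj (p k) (p (k + 1))) :
    ∃ W : G.Walk (p 0) (p a), W.length = a ∧ W.support = (List.range (a + 1)).map p ∧
      W.edges = (List.range a).map (fun k => s(p k, p (k + 1))) := by
  induction a with
  | zero => exact ⟨Walk.nil, rfl, by simp, by simp⟩
  | succ a ih =>
    obtain ⟨W, h1, h2, h3⟩ := ih (fun k hk => h k (by omega))
    refine ⟨W.concat (h a (by omega)), ?_, ?_, ?_⟩
    · simp [h1]
    · rw [Walk.support_concat, h2, List.range_succ (n := a + 1)]; simp
    · rw [Walk.edges_concat, h3, List.range_succ (n := a)]; simp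

/-- The path traced out by a sequence of successively adjacent, distinct vertices. -/
theorem exists_path_of_fun {V : Type*} {G : SimpleGraph V} {u v : V} (p : ℕ → V) (a : ℕ)
    (hu : p 0 = u) (hv : p a = v)
    (h : ∀ k < a, G.Adj (p k) (p (k + 1)))
    (hinj : ∀ i j, i < j → j ≤ a → p i ≠ p j) :
    ∃ W : G.Walk u v, W.IsPath ∧ W.length = a ∧
      W.support = (List.range (a + 1)).map p ∧
      W.edges = (List.range a).map (fun k => s(p k, p (k + 1))) := by
  subst hu hv
  obtain ⟨W, h1, h2, h3⟩ := exists_walk_of_fun p a h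
  refine ⟨W, ?_, h1, h2, h3⟩
  rw [Walk.isPath_def, h2]
  refine List.Nodup.map_on ?_ List.nodup_range
  intro x hx y hy hxy
  simp only [List.mem_range] at hx hy
  rcases lt_trichotomy x y with hlt | heq | hlt
  · exact absurd hxy (hinj x y hlt (by omega))
  · exact heq
  · exact absurd hxy.symm (hinj y x hlt (by omega))

theorem mem_support_of_fun {V : Type*} {G : SimpleGraph V} {u v : V} {p : ℕ → V} {a : ℕ}
    {W : G.Walk u v} (h : W.support = (List.range (a + 1)).map p) {x : V} :
    x ∈ W.support ↔ ∃ k, k ≤ a ∧ p k = x := by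
  rw [h]; simp

theorem mem_inter_of_fun {V : Type*} {G : SimpleGraph V} {u v : V} {p : ℕ → V} {a : ℕ}
    (hu : p 0 = u) (hv : p a = v) (hinj : ∀ i j, i < j → j ≤ a → p i ≠ p j)
    {W : G.Walk u v} (h : W.support = (List.range (a + 1)).map p) {x : V} :
    x ∈ inter W ↔ ∃ k, 0 < k ∧ k < a ∧ p k = x := by
  subst hu hv
  simp only [inter, Set.mem_ofPred_eq, mem_support_of_fun h]
  constructor
  · rintro ⟨⟨k, hk, rfl⟩, h0, ha⟩
    refine ⟨k, Nat.pos_of_ne_zero ?_, lt_of_le_of_ne hk ?_, rfl⟩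
    · rintro rfl; exact h0 rfl
    · rintro rfl; exact ha rfl
  · rintro ⟨k, h0, ha, rfl⟩
    exact ⟨⟨k, ha.le, rfl⟩, (hinj 0 k h0 ha.le).symm, hinj k a ha le_rfl⟩

/-- An induced path given by a sequence of vertices. -/
theorem exists_inducedPath_of_fun {V : Type*} {G : SimpleGraph V} {u v : V} (p : ℕ → V) (a : ℕ)
    (hu : p 0 = u) (hv : p a = v)
    (hinj : ∀ i j, i < j → j ≤ a → p i ≠ p j)
    (h : ∀ i j, i < j → j ≤ a → (G.Adj (p i) (p j) ↔ j = i + 1)) :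
    ∃ W : G.Walk u v, IsInducedPath W ∧ W.length = a ∧
      W.support = (List.range (a + 1)).map p ∧
      (∀ x, x ∈ inter W ↔ ∃ k, 0 < k ∧ k < a ∧ p k = x) := by
  obtain ⟨W, h0, h1, h2, h3⟩ := exists_path_of_fun p a hu hv
    (fun k hk => (h k (k + 1) (by omega) (by omega)).2 rfl) hinj
  refine ⟨W, ⟨h0, ?_⟩, h1, h2, fun x => mem_inter_of_fun hu hv hinj h2⟩
  intro x hx y hy hxy
  obtain ⟨i, hi, rfl⟩ := (mem_support_of_fun h2).1 hx
  obtain ⟨j, hj, rfl⟩ := (mem_support_of_fun h2).1 hy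
  rw [h3, List.mem_map]
  rcases lt_trichotomy i j with hlt | heq | hlt
  · have := (h i j hlt hj).1 hxy
    exact ⟨i, by simp; omega, by rw [this]⟩
  · subst heq; exact absurd hxy (G.loopless.irrefl _)
  · have := (h j i hlt hi).1 hxy.symm
    exact ⟨j, by simp; omega, by rw [this, Sym2.eq_swap]⟩

/-- A hole given by a cyclic sequence of vertices. -/
theorem exists_hole_of_fun {V : Type*} {G : SimpleGraph V} (D : ℕ → V) (m : ℕ) (hm : 4 ≤ m)
    (hinj : ∀ i j, i < j → j < m → D i ≠ D j)
    (h : ∀ i j, i < j → j < m → (G.Adj (D i) (D j) ↔ j = i + 1 ∨ (i = 0 ∧ j = m - 1))) :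
    ∃ (u : V) (c : G.Walk u u), IsHole c ∧ c.length = m ∧
      ∀ x, x ∈ c.support ↔ ∃ k, k < m ∧ D k = x := by
  obtain ⟨W, h0, h1, h2, h3⟩ := exists_path_of_fun (G := G) (fun k => D (k + 1)) (m - 2) rfl rfl
    (fun k hk => (h (k + 1) (k + 2) (by omega) (by omega)).2 (Or.inl rfl))
    (fun i j hij hj => hinj _ _ (by omega) (by omega))
  have e : m - 2 + 1 = m - 1 := by omega
  have hadj : G.Adj (D (m - 2 + 1)) (D 0) :=
    ((h 0 (m - 2 + 1) (by omega) (by omega)).2 (Or.inr ⟨rfl, e⟩)).symm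
  have hadj' : G.Adj (D 0) (D (0 + 1)) :=
    (h 0 1 (by omega) (by omega)).2 (Or.inl rfl)
  have hns : D 0 ∉ W.support := by
    intro hx
    obtain ⟨k, hk, hk'⟩ := (mem_support_of_fun h2).1 hx
    exact hinj 0 (k + 1) (by omega) (by omega) hk'.symm
  have hsup : ∀ x, x ∈ (Walk.cons hadj' (W.concat hadj)).support ↔ ∃ k, k < m ∧ D k = x := by
    intro x
    rw [Walk.support_cons, Walk.support_concat, List.mem_cons, List.mem_append,
      mem_support_of_fun h2, List.mem_singleton]
    constructor
    · rintro (rfl | ⟨k, hk, rfl⟩ | rfl)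
      · exact ⟨0, by omega, rfl⟩
      · exact ⟨k + 1, by omega, rfl⟩
      · exact ⟨0, by omega, rfl⟩
    · rintro ⟨k, hk, rfl⟩
      rcases k with _ | k
      · exact Or.inl rfl
      · exact Or.inr (Or.inl ⟨k, by omega, rfl⟩)
  refine ⟨D 0, Walk.cons hadj' (W.concat hadj), ⟨?_, ?_, ?_⟩, ?_, hsup⟩
  · rw [Walk.cons_isCycle_iff]
    refine ⟨?_, ?_⟩
    · rw [Walk.isPath_def, Walk.support_concat, List.nodup_append]
      refine ⟨h0.support_nodup, by simp, ?_⟩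
      intro a ha b hb hab
      simp only [List.mem_singleton] at hb
      subst hb; subst hab; exact hns ha
    · rw [Walk.edges_concat, List.concat_eq_append, List.mem_append, h3]
      simp only [List.mem_map, List.mem_range, List.mem_singleton]
      rintro (⟨k, hk, hk'⟩ | hk)
      · rw [Sym2.eq_iff] at hk'
        rcases hk' with ⟨e1, -⟩ | ⟨-, e1⟩
        · exact hinj 0 (k + 1) (by omega) (by omega) e1.symm
        · exact hinj 0 (k + 1 + 1) (by omega) (by omega) e1.symm
      · rw [Sym2.eq_iff] at hk
        rcases hk with ⟨e1, -⟩ | ⟨-, e1⟩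
        · exact hinj 0 (m - 2 + 1) (by omega) (by omega) e1
        · exact hinj 1 (m - 2 + 1) (by omega) (by omega) e1
  · simp [h1]; omega
  · have key : ∀ i j, i < j → j < m → G.Adj (D i) (D j) →
        s(D i, D j) ∈ (Walk.cons hadj' (W.concat hadj)).edges := by
      intro i j hij hj hA
      rw [Walk.edges_cons, Walk.edges_concat, List.concat_eq_append, List.mem_cons,
        List.mem_append, h3, List.mem_map, List.mem_singleton]
      rcases (h i j hij hj).1 hA with rfl | ⟨rfl, rfl⟩
      · rcases i with _ | i
        · exact Or.inl rfl
        · exact Or.inr (Or.inl ⟨i, by simp; omega, rfl⟩)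
      · exact Or.inr (Or.inr (by rw [e, Sym2.eq_swap]))
    intro x hx y hy hxy
    obtain ⟨i, hi, rfl⟩ := (hsup x).1 hx
    obtain ⟨j, hj, rfl⟩ := (hsup y).1 hy
    rcases lt_trichotomy i j with hlt | heq | hlt
    · exact key i j hlt hj hxy
    · subst heq; exact absurd hxy (G.loopless.irrefl _)
    · rw [Sym2.eq_swap]; exact key j i hlt hi hxy.symm
  · simp [h1]; omega

/-- The vertices of a hole of length `n`, indexed cyclically by the integers. -/
structure CyclicHole {V : Type*} (G : SimpleGraph V) (n : ℤ) (C : ℤ → V) : Prop where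
  eq_iff : ∀ i j, C i = C j ↔ n ∣ i - j
  adj_iff : ∀ i j, G.Adj (C i) (C j) ↔ n ∣ i - j - 1 ∨ n ∣ i - j + 1

theorem IsHole.exists_cyclicHole {V : Type*} {G : SimpleGraph V} {u : V} {c : G.Walk u u}
    (hc : IsHole c) :
    ∃ C : ℤ → V, CyclicHole G c.length C ∧ (∀ x, x ∈ c.support ↔ ∃ k, C k = x) ∧
      ∀ k, s(C k, C (k + 1)) ∈ c.edges := by
  obtain ⟨hcyc, hlen, hind⟩ := hc
  obtain ⟨n, hn⟩ : ∃ n : ℤ, n = c.length := ⟨_, rfl⟩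
  have hn4 : 4 ≤ n := by omega
  rw [← hn]
  set C : ℤ → V := fun i => c.getVert (i % n).toNat with hC
  have hmod : ∀ i : ℤ, 0 ≤ i % n ∧ i % n < n :=
    fun i => ⟨Int.emod_nonneg _ (by omega), Int.emod_lt_of_pos _ (by omega)⟩
  have hnat : ∀ a : ℕ, a ≤ c.length → C a = c.getVert a := by
    intro a ha
    rcases ha.lt_or_eq with h | h
    · simp only [hC]
      rw [Int.emod_eq_of_lt (by omega) (by omega), Int.toNat_natCast]
    · simp only [hC]
      rw [h, ← hn, Int.emod_self]
      simp
  have heq : ∀ i j, C i = C j ↔ n ∣ i - j := by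
    intro i j
    have hi := hmod i
    have hj := hmod j
    rw [← neg_sub, dvd_neg, ← Int.modEq_iff_dvd]
    refine ⟨fun h => ?_, fun h => by simp only [hC]; rw [h]⟩
    have := hcyc.getVert_injOn' (Set.mem_ofPred_eq ▸ by omega) (Set.mem_ofPred_eq ▸ by omega) h
    unfold Int.ModEq
    omega
  have hstep : ∀ k, ∃ r : ℕ, r < c.length ∧ C k = c.getVert r ∧ C (k + 1) = c.getVert (r + 1) := by
    intro k
    have hk := hmod k
    refine ⟨(k % n).toNat, by omega, rfl, ?_⟩
    rw [← hnat _ (by omega), heq]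
    have := Int.emod_add_mul_ediv k n
    refine ⟨k / n, ?_⟩
    push_cast
    rw [Int.toNat_of_nonneg hk.1]
    linarith
  have hsup : ∀ x, x ∈ c.support ↔ ∃ k, C k = x := by
    intro x
    rw [Walk.mem_support_iff_exists_getVert]
    constructor
    · rintro ⟨m, rfl, hm⟩; exact ⟨m, hnat m hm⟩
    · rintro ⟨k, rfl⟩; exact ⟨_, rfl, by have := hmod k; omega⟩
  have hedge : ∀ k, s(C k, C (k + 1)) ∈ c.edges := by
    intro k
    obtain ⟨r, hr, h1, h2⟩ := hstep k
    rw [h1, h2, ← Walk.mem_edges_toSubgraph, Subgraph.mem_edgeSet, Walk.toSubgraph_adj_iff]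
    exact ⟨r, rfl, hr⟩
  refine ⟨C, ⟨heq, ?_⟩, hsup, hedge⟩
  intro i j
  constructor
  · intro h
    have := hind _ ((hsup _).2 ⟨i, rfl⟩) _ ((hsup _).2 ⟨j, rfl⟩) h
    rw [← Walk.mem_edges_toSubgraph, Subgraph.mem_edgeSet, Walk.toSubgraph_adj_iff] at this
    obtain ⟨k, hk, hk'⟩ := this
    rw [← hnat k (by omega), ← hnat (k + 1) (by omega), Sym2.eq_iff, heq, heq, heq, heq] at hk
    push_cast at hk
    rcases hk with ⟨a, b⟩ | ⟨a, b⟩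
    · right
      have := dvd_sub b a
      rwa [show (k:ℤ) + 1 - j - (k - i) = i - j + 1 by ring] at this
    · left
      have := dvd_sub a b
      rwa [show (k:ℤ) - j - (k + 1 - i) = i - j - 1 by ring] at this
  · rintro (h | h)
    · have e : C i = C (j + 1) := (heq _ _).2 (by convert h using 1; ring)
      rw [e]; exact (c.adj_of_mem_edges (hedge j)).symm
    · have e : C j = C (i + 1) := (heq _ _).2 (by
        rwa [← dvd_neg, show -(j - (i + 1)) = i - j + 1 by ring])
      rw [e]; exact c.adj_of_mem_edges (hedge i)

namespace CyclicHole

variable {V : Type*} {G : SimpleGraph V} {n : ℤ} {C : ℤ → V}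

theorem shift (h : CyclicHole G n C) (s : ℤ) : CyclicHole G n (fun i => C (i + s)) where
  eq_iff i j := by rw [h.eq_iff]; ring_nf
  adj_iff i j := by
    rw [h.adj_iff, show i + s - (j + s) = i - j by ring]

theorem add_period (h : CyclicHole G n C) (i : ℤ) : C (i + n) = C i :=
  (h.eq_iff _ _).2 ⟨1, by ring⟩

theorem sub_period (h : CyclicHole G n C) (i : ℤ) : C (i - n) = C i :=
  (h.eq_iff _ _).2 ⟨-1, by ring⟩

theorem ne_of_lt (h : CyclicHole G n C) {i j : ℤ} (h1 : i < j) (h2 : j < i + n) : C i ≠ C j := by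
  rw [Ne, h.eq_iff]
  intro hd
  have := Int.eq_zero_of_abs_lt_dvd hd (by rw [abs_lt]; omega)
  omega

theorem not_dvd {m : ℤ} (h0 : m ≠ 0) (h1 : -n < m) (h2 : m < n) : ¬ n ∣ m := fun hd =>
  h0 (Int.eq_zero_of_abs_lt_dvd hd (by rw [abs_lt]; omega))

theorem adj_of_lt (h : CyclicHole G n C) {i j : ℤ} (h1 : i < j) (h2 : j < i + n) :
    G.Adj (C i) (C j) ↔ j = i + 1 ∨ j = i + n - 1 := by
  rw [h.adj_iff]
  constructor
  · rintro (hd | hd)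
    · right
      have : n ∣ (i - j - 1 + n) := (dvd_add_self_right).2 hd
      by_contra hne
      exact not_dvd (m := i - j - 1 + n) (by omega) (by omega) (by omega) this
    · left
      by_contra hne
      exact not_dvd (m := i - j + 1) (by omega) (by omega) (by omega) hd
  · rintro (rfl | rfl)
    · right; simp
    · left; exact ⟨-1, by ring⟩

theorem adj_of_lt' (h : CyclicHole G n C) {i j : ℤ} (h1 : i < j) (h2 : j < i + n - 1) :
    G.Adj (C i) (C j) ↔ j = i + 1 := by
  rw [h.adj_of_lt h1 (by omega)]; omega

theorem adj_succ (h : CyclicHole G n C) (i : ℤ) : G.Adj (C i) (C (i + 1)) := by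
  rw [h.adj_iff]; right; simp

end CyclicHole

/-- The hole formed by two induced paths joining `x` and `y`. -/
theorem exists_hole_of_two_routes {V : Type*} {G : SimpleGraph V} {x y : V} (p q : ℕ → V) (a b : ℕ)
    (hxy : x ≠ y) (hnxy : ¬ G.Adj x y)
    (hp : ∀ i j, i < j → j ≤ a → p i ≠ p j ∧ (G.Adj (p i) (p j) ↔ j = i + 1))
    (hq : ∀ i j, i < j → j ≤ b → q i ≠ q j ∧ (G.Adj (q i) (q j) ↔ j = i + 1))
    (hpq : ∀ i j, i ≤ a → j ≤ b → p i ≠ q j ∧ ¬ G.Adj (p i) (q j))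
    (hxp : ∀ i, i ≤ a → x ≠ p i ∧ (G.Adj x (p i) ↔ i = 0))
    (hxq : ∀ i, i ≤ b → x ≠ q i ∧ (G.Adj x (q i) ↔ i = 0))
    (hyp : ∀ i, i ≤ a → y ≠ p i ∧ (G.Adj y (p i) ↔ i = a))
    (hyq : ∀ i, i ≤ b → y ≠ q i ∧ (G.Adj y (q i) ↔ i = b)) :
    ∃ (u : V) (c : G.Walk u u), IsHole c ∧ c.length = a + b + 4 := by
  obtain ⟨D, hD⟩ : ∃ D : ℕ → V, D = fun k => if k = 0 then x else if k ≤ a + 1 then p (k - 1) else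
    if k = a + 2 then y else q (a + b + 3 - k) := ⟨_, rfl⟩
  have hD0 : D 0 = x := by rw [hD]; rfl
  have hDp : ∀ k, 0 < k → k ≤ a + 1 → D k = p (k - 1) := by
    intro k h1 h2; simp [hD, h1.ne', h2]
  have hDy : D (a + 2) = y := by simp [hD]
  have hDq : ∀ k, a + 2 < k → D k = q (a + b + 3 - k) := by
    intro k h1
    simp [hD, show k ≠ 0 by omega, show ¬ k ≤ a + 1 by omega, show k ≠ a + 2 by omega]
  have key : ∀ i j, i < j → j < a + b + 4 →
      D i ≠ D j ∧ (G.Adj (D i) (D j) ↔ j = i + 1 ∨ (i = 0 ∧ j = a + b + 4 - 1)) := by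
    intro i j hij hj
    rcases Nat.eq_zero_or_pos i with rfl | hi
    · rw [hD0]
      rcases lt_trichotomy j (a + 2) with h | rfl | h
      · rw [hDp j hij (by omega)]
        have := hxp (j - 1) (by omega)
        exact ⟨this.1, this.2.trans (by omega)⟩
      · rw [hDy]; exact ⟨hxy, iff_of_false hnxy (by omega)⟩
      · rw [hDq j h]
        have := hxq (a + b + 3 - j) (by omega)
        exact ⟨this.1, this.2.trans (by omega)⟩
    · rcases lt_trichotomy i (a + 2) with h | rfl | h
      · rw [hDp i hi (by omega)]
        rcases lt_trichotomy j (a + 2) with h' | rfl | h'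
        · rw [hDp j (by omega) (by omega)]
          have := hp (i - 1) (j - 1) (by omega) (by omega)
          exact ⟨this.1, this.2.trans (by omega)⟩
        · rw [hDy]
          have := hyp (i - 1) (by omega)
          refine ⟨this.1.symm, ?_⟩
          rw [G.adj_comm, this.2]; omega
        · rw [hDq j h']
          have := hpq (i - 1) (a + b + 3 - j) (by omega) (by omega)
          exact ⟨this.1, iff_of_false this.2 (by omega)⟩
      · rw [hDy, hDq j (by omega)]
        have := hyq (a + b + 3 - j) (by omega)
        exact ⟨this.1, this.2.trans (by omega)⟩
      · rw [hDq i h, hDq j (by omega)]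
        have := hq (a + b + 3 - j) (a + b + 3 - i) (by omega) (by omega)
        refine ⟨this.1.symm, ?_⟩
        rw [G.adj_comm, this.2]; omega
  obtain ⟨u, c, h1, h2, -⟩ := exists_hole_of_fun D (a + b + 4) (by omega)
    (fun i j h h' => (key i j h h').1) (fun i j h h' => (key i j h h').2)
  exact ⟨u, c, h1, h2⟩

/-- A cyclically indexed hole that is a shortest long even hole of a candidate. -/
structure ShortestHole {V : Type*} (G : SimpleGraph V) (ℓ : ℕ) (n : ℤ) (C : ℤ → V) : Prop
    extends CyclicHole G n C where
  six_le : 6 ≤ ℓ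
  even_bound : (ℓ : ℤ) % 2 = 0
  even_length : n % 2 = 0
  long : 2 * ℓ + 2 ≤ n
  shortest : ∀ (u : V) (c : G.Walk u u), IsHole c → ℓ ≤ c.length → (c.length : ℤ) % 2 = 0 →
    n ≤ c.length
  no_jewel : ∀ k ≤ ℓ + 1, ¬ HasLongJewel G ℓ k
  no_theta : ¬ HasLongTheta G ℓ
  no_prism : ¬ HasLongNearPrism G ℓ

/-- The cyclic version of `CMajor`. -/
def Major {V : Type*} (G : SimpleGraph V) (n : ℤ) (C : ℤ → V) (x : V) : Prop :=
  (∀ i, x ≠ C i) ∧ ∀ q, ∃ k, q + 2 ≤ k ∧ k ≤ q + n - 2 ∧ G.Adj x (C k)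

theorem Major.shift {V : Type*} {G : SimpleGraph V} {n : ℤ} {C : ℤ → V} {x : V}
    (h : Major G n C x) (s : ℤ) : Major G n (fun i => C (i + s)) x := by
  refine ⟨fun i => h.1 _, fun q => ?_⟩
  obtain ⟨k, h1, h2, h3⟩ := h.2 (q + s)
  exact ⟨k - s, by omega, by omega, by simpa using h3⟩

namespace ShortestHole

variable {V : Type*} {G : SimpleGraph V} {ℓ : ℕ} {n : ℤ} {C : ℤ → V}

theorem shift (h : ShortestHole G ℓ n C) (s : ℤ) : ShortestHole G ℓ n (fun i => C (i + s)) :=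
  { h with toCyclicHole := h.toCyclicHole.shift s }

/-- The hole formed by `x` and a path of `C` with both ends, but no interior vertex,
adjacent to `x`. -/
theorem exists_gap_hole (h : ShortestHole G ℓ n C) {x : V} (hx : ∀ i, x ≠ C i) {a L : ℤ}
    (hL : 2 ≤ L) (hLn : L ≤ n - 2) (h1 : G.Adj x (C a)) (h2 : G.Adj x (C (a + L)))
    (h3 : ∀ k, a < k → k < a + L → ¬ G.Adj x (C k)) :
    ∃ (u : V) (c : G.Walk u u), IsHole c ∧ (c.length : ℤ) = L + 2 ∧
      ∀ v, v ∈ c.support ↔ v = x ∨ ∃ k, a ≤ k ∧ k ≤ a + L ∧ C k = v := by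
  obtain ⟨D, hD⟩ : ∃ D : ℕ → V, D = fun k : ℕ => if k = 0 then x else C (a + k - 1) := ⟨_, rfl⟩
  have hD0 : D 0 = x := by rw [hD]; rfl
  have hDp : ∀ k, 0 < k → D k = C (a + k - 1) := by
    intro k h1; simp [hD, h1.ne']
  have hxC : ∀ k, a ≤ k → k ≤ a + L → (G.Adj x (C k) ↔ k = a ∨ k = a + L) := by
    intro k hk1 hk2
    constructor
    · intro hk; by_contra hne; push Not at hne; exact h3 k (by omega) (by omega) hk
    · rintro (rfl | rfl) <;> assumption
  have key : ∀ i j, i < j → j < L.toNat + 2 →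
      D i ≠ D j ∧ (G.Adj (D i) (D j) ↔ j = i + 1 ∨ (i = 0 ∧ j = L.toNat + 2 - 1)) := by
    intro i j hij hj
    rcases Nat.eq_zero_or_pos i with rfl | hi
    · rw [hD0, hDp j hij]
      exact ⟨hx _, (hxC _ (by omega) (by omega)).trans (by omega)⟩
    · rw [hDp i hi, hDp j (by omega)]
      exact ⟨h.ne_of_lt (by omega) (by omega), (h.adj_of_lt' (by omega) (by omega)).trans (by omega)⟩
  obtain ⟨u, c, e1, e2, e3⟩ := exists_hole_of_fun D (L.toNat + 2) (by omega)
    (fun i j h h' => (key i j h h').1) (fun i j h h' => (key i j h h').2)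
  refine ⟨u, c, e1, by omega, fun v => (e3 v).trans ?_⟩
  constructor
  · rintro ⟨k, hk, rfl⟩
    rcases Nat.eq_zero_or_pos k with rfl | hk0
    · exact Or.inl hD0
    · exact Or.inr ⟨a + k - 1, by omega, by omega, (hDp k hk0).symm⟩
  · rintro (rfl | ⟨k, hk1, hk2, rfl⟩)
    · exact ⟨0, by omega, hD0⟩
    · refine ⟨(k - a + 1).toNat, by omega, ?_⟩
      rw [hDp _ (by omega)]
      congr 1
      omega

theorem odd_gap (h : ShortestHole G ℓ n C) {x : V} (hx : ∀ i, x ≠ C i) {a L : ℤ}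
    (hL : 2 ≤ L) (hLn : L ≤ n - 3) (h1 : G.Adj x (C a)) (h2 : G.Adj x (C (a + L)))
    (h3 : ∀ k, a < k → k < a + L → ¬ G.Adj x (C k)) : L % 2 = 1 ∨ L + 2 < ℓ := by
  obtain ⟨u, c, e1, e2, -⟩ := h.exists_gap_hole hx hL (by omega) h1 h2 h3
  by_contra hcon
  push Not at hcon
  have := h.shortest u c e1 (by omega) (by omega)
  omega

/-- The length of the hole formed by `x`, `y` and two paths of `C`. -/
theorem two_routes (h : ShortestHole G ℓ n C) {x y : V} (hx : ∀ i, x ≠ C i) (hy : ∀ i, y ≠ C i)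
    (hxy : x ≠ y) (hnxy : ¬ G.Adj x y) (i i' j j' : ℤ)
    (hsep : max i i' + 2 ≤ min j j') (hsep' : max j j' ≤ min i i' + n - 2)
    (hxi : G.Adj x (C i)) (hyi : G.Adj y (C i')) (hxj : G.Adj x (C j)) (hyj : G.Adj y (C j'))
    (hi : ∀ k, min i i' ≤ k → k ≤ max i i' →
      (G.Adj x (C k) → k = i) ∧ (G.Adj y (C k) → k = i'))
    (hj : ∀ k, min j j' ≤ k → k ≤ max j j' →
      (G.Adj x (C k) → k = j) ∧ (G.Adj y (C k) → k = j')) :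
    (max i i' - min i i' + (max j j' - min j j')) % 2 = 1 ∨
    max i i' - min i i' + (max j j' - min j j') + 4 < ℓ ∨
    n ≤ max i i' - min i i' + (max j j' - min j j') + 4 := by
  have route : ∀ i i' : ℤ, ∃ f : ℕ → ℤ, f 0 = i ∧ f (max i i' - min i i').toNat = i' ∧
      (∀ k, k ≤ (max i i' - min i i').toNat → min i i' ≤ f k ∧ f k ≤ max i i') ∧
      ∀ k l, k < l → l ≤ (max i i' - min i i').toNat → (f l - f k = l - k ∨ f k - f l = l - k) := by
    intro i i'
    rcases le_total i i' with hle | hle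
    · exact ⟨fun k => i + k, by simp, by dsimp only; omega, fun k hk => by dsimp only; omega,
        fun k l hk hl => by dsimp only; omega⟩
    · exact ⟨fun k => i - k, by simp, by dsimp only; omega, fun k hk => by dsimp only; omega,
        fun k l hk hl => by dsimp only; omega⟩
  obtain ⟨f, f0, f1, f2, f3⟩ := route i i'
  obtain ⟨g, g0, g1, g2, g3⟩ := route j j'
  have hmono : ∀ s t : ℤ, ∀ k l : ℕ, k < l → (l : ℤ) - k ≤ n - 2 →
      (t - s = l - k ∨ s - t = l - k) → C s ≠ C t ∧ (G.Adj (C s) (C t) ↔ l = k + 1) := by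
    intro s t k l hkl hln hst
    rcases hst with hst | hst
    · exact ⟨h.ne_of_lt (by omega) (by omega), (h.adj_of_lt' (by omega) (by omega)).trans (by omega)⟩
    · refine ⟨(h.ne_of_lt (by omega) (by omega)).symm, ?_⟩
      rw [G.adj_comm]
      exact (h.adj_of_lt' (by omega) (by omega)).trans (by omega)
  have finj : ∀ k l, k ≤ (max i i' - min i i').toNat → l ≤ (max i i' - min i i').toNat →
      (f k = f l ↔ k = l) := by
    intro k l hk hl
    constructor
    · intro e
      rcases lt_trichotomy k l with hlt | heq | hlt
      · have := f3 k l hlt hl; omega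
      · exact heq
      · have := f3 l k hlt hk; omega
    · rintro rfl; rfl
  have ginj : ∀ k l, k ≤ (max j j' - min j j').toNat → l ≤ (max j j' - min j j').toNat →
      (g k = g l ↔ k = l) := by
    intro k l hk hl
    constructor
    · intro e
      rcases lt_trichotomy k l with hlt | heq | hlt
      · have := g3 k l hlt hl; omega
      · exact heq
      · have := g3 l k hlt hk; omega
    · rintro rfl; rfl
  have := exists_hole_of_two_routes (G := G) (x := x) (y := y) (fun k => C (f k)) (fun k => C (g k))
    (max i i' - min i i').toNat (max j j' - min j j').toNat hxy hnxy
    (fun k l hk hl => hmono _ _ _ _ hk (by omega) (f3 k l hk hl))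
    (fun k l hk hl => hmono _ _ _ _ hk (by omega) (g3 k l hk hl))
    (fun k l hk hl => by
      have a1 := f2 k hk
      have a2 := g2 l hl
      refine ⟨h.ne_of_lt (by omega) (by omega), ?_⟩
      rw [h.adj_of_lt (by omega) (by omega)]
      omega)
    (fun k hk => ⟨hx _, by
      have a1 := f2 k hk
      rw [← finj k 0 hk (by omega), f0]
      exact ⟨fun hh => (hi _ a1.1 a1.2).1 hh, fun hh => by rwa [hh]⟩⟩)
    (fun k hk => ⟨hx _, by
      have a1 := g2 k hk
      rw [← ginj k 0 hk (by omega), g0]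
      exact ⟨fun hh => (hj _ a1.1 a1.2).1 hh, fun hh => by rwa [hh]⟩⟩)
    (fun k hk => ⟨hy _, by
      have a1 := f2 k hk
      rw [← finj k _ hk le_rfl, f1]
      exact ⟨fun hh => (hi _ a1.1 a1.2).2 hh, fun hh => by rwa [hh]⟩⟩)
    (fun k hk => ⟨hy _, by
      have a1 := g2 k hk
      rw [← ginj k _ hk le_rfl, g1]
      exact ⟨fun hh => (hj _ a1.1 a1.2).2 hh, fun hh => by rwa [hh]⟩⟩)
  obtain ⟨u, c, hc, hlen⟩ := this
  by_contra hcon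
  push Not at hcon
  have := h.shortest u c hc (by omega) (by omega)
  omega

end ShortestHole

theorem IsInducedPath.reverse {V : Type*} {G : SimpleGraph V} {u v : V} {P : G.Walk u v}
    (h : IsInducedPath P) : IsInducedPath P.reverse := by
  refine ⟨h.1.reverse, ?_⟩
  simp only [Walk.support_reverse, Walk.edges_reverse, List.mem_reverse]
  exact h.2

theorem mem_inter_reverse {V : Type*} {G : SimpleGraph V} {u v : V} {P : G.Walk u v} {x : V} :
    x ∈ inter P.reverse ↔ x ∈ inter P := by
  simp only [inter, Set.mem_ofPred_eq, Walk.support_reverse, List.mem_reverse]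
  tauto

theorem exists_inducedPath_of_length_two {V : Type*} {G : SimpleGraph V} {u x v : V}
    (hux : G.Adj u x) (hxv : G.Adj x v) (huv : u ≠ v) (hn : ¬ G.Adj u v) :
    ∃ W : G.Walk u v, IsInducedPath W ∧ W.length = 2 ∧ ∀ y, y ∈ inter W ↔ y = x := by
  refine ⟨Walk.cons hux (Walk.cons hxv Walk.nil), ⟨?_, ?_⟩, rfl, ?_⟩
  · rw [Walk.isPath_def]
    simp [hux.ne, hxv.ne, huv]
  · simp only [Walk.support_cons, Walk.support_nil, List.mem_cons, List.not_mem_nil, or_false,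
      Walk.edges_cons, Walk.edges_nil]
    have hn' : ¬ G.Adj v u := fun h => hn h.symm
    rintro a (rfl | rfl | rfl) b (rfl | rfl | rfl) hab <;>
      first
      | exact absurd hab (G.loopless.irrefl _)
      | exact absurd hab hn
      | exact absurd hab hn'
      | simp
  · intro y
    simp only [inter, Set.mem_ofPred_eq, Walk.support_cons, Walk.support_nil, List.mem_cons,
      List.not_mem_nil, or_false]
    constructor
    · tauto
    · rintro rfl; exact ⟨Or.inr (Or.inl rfl), hux.ne', hxv.ne⟩

namespace CyclicHole

variable {V : Type*} {G : SimpleGraph V} {n : ℤ} {C : ℤ → V}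

theorem exists_arc (h : CyclicHole G n C) {s t : ℤ} {u v : V} (hst : s ≤ t) (hn : t ≤ s + n - 2)
    (hu : C s = u) (hv : C t = v) :
    ∃ W : G.Walk u v, IsInducedPath W ∧ (W.length : ℤ) = t - s ∧
      (∀ x, x ∈ W.support ↔ ∃ k, s ≤ k ∧ k ≤ t ∧ C k = x) ∧
      ∀ x, x ∈ inter W ↔ ∃ k, s < k ∧ k < t ∧ C k = x := by
  obtain ⟨W, h1, h2, h3, h4⟩ := exists_inducedPath_of_fun (G := G) (fun k : ℕ => C (s + k))
    (t - s).toNat (u := u) (v := v) (by simpa using hu)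
    (by rw [← hv]; congr 1; omega)
    (fun i j hij hj => h.ne_of_lt (by omega) (by omega))
    (fun i j hij hj => (h.adj_of_lt' (by omega) (by omega)).trans (by omega))
  refine ⟨W, h1, by omega, fun x => (mem_support_of_fun h3).trans ?_, fun x => (h4 x).trans ?_⟩
  · constructor
    · rintro ⟨k, hk, rfl⟩; exact ⟨s + k, by omega, by omega, rfl⟩
    · rintro ⟨k, hk, hk', rfl⟩
      exact ⟨(k - s).toNat, by omega, by congr 1; omega⟩
  · constructor
    · rintro ⟨k, hk, hk', rfl⟩; exact ⟨s + k, by omega, by omega, rfl⟩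
    · rintro ⟨k, hk, hk', rfl⟩
      exact ⟨(k - s).toNat, by omega, by omega, by congr 1; omega⟩

/-- The path of the hole complementary to the path from `C a` to `C (a + D)`. -/
theorem exists_co_arc (h : CyclicHole G n C) {a D : ℤ} (hD : 2 ≤ D) (hn : D ≤ n) :
    ∃ W : G.Walk (C a) (C (a + D)), IsInducedPath W ∧ (W.length : ℤ) = n - D ∧
      (∀ x, x ∈ W.support ↔ ∃ k, a + D ≤ k ∧ k ≤ a + n ∧ C k = x) ∧
      ∀ x, x ∈ inter W ↔ ∃ k, a + D < k ∧ k < a + n ∧ C k = x := by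
  obtain ⟨W, h1, h2, h3, h4⟩ := h.exists_arc (s := a + D) (t := a + n) (by omega) (by omega)
    rfl (h.add_period a)
  refine ⟨W.reverse, h1.reverse, by rw [Walk.length_reverse]; omega, fun x => ?_, fun x => ?_⟩
  · rw [Walk.support_reverse, List.mem_reverse, h3]
  · rw [mem_inter_reverse, h4]

end CyclicHole

namespace ShortestHole

variable {V : Type*} {G : SimpleGraph V} {ℓ : ℕ} {n : ℤ} {C : ℤ → V}

theorem jewel_free (h : ShortestHole G ℓ n C) {x : V} (hx : ∀ i, x ≠ C i) {a D : ℤ}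
    (hD : D % 2 = 1) (h3 : 3 ≤ D) (hDl : D ≤ ℓ) (h1 : G.Adj x (C a)) (h2 : G.Adj x (C (a + D)))
    (hout : ∀ k, a + D < k → k < a + n → ¬ G.Adj x (C k)) : False := by
  have hlong := h.long
  have hsix := h.six_le
  obtain ⟨Q₁, q1, q2, -, q3⟩ := h.exists_arc (s := a) (t := a + D) (by omega) (by omega) rfl rfl
  have hne : C a ≠ C (a + D) := h.ne_of_lt (by omega) (by omega)
  obtain ⟨Q₂, r1, r2, r3⟩ := exists_inducedPath_of_length_two h1.symm h2 hne
    (by rw [h.adj_of_lt (by omega) (by omega)]; omega)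
  obtain ⟨P, p1, p2, -, p3⟩ := h.exists_co_arc (a := a) (D := D) (by omega) (by omega)
  refine h.no_jewel (max Q₁.support.length Q₂.support.length) ?_
    ⟨_, _, Q₁, Q₂, P, hne, q1, r1, p1, ?_, rfl, ?_, ?_⟩
  · rw [Walk.length_support, Walk.length_support]; omega
  · rw [Nat.even_iff, Nat.even_iff]; omega
  · omega
  · rintro y hy z (hz | hz)
    · obtain ⟨k, hk, hk', rfl⟩ := (p3 _).1 hy
      obtain ⟨l, hl, hl', rfl⟩ := (q3 _).1 hz
      refine ⟨(h.ne_of_lt (by omega) (by omega)).symm, ?_⟩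
      rw [G.adj_comm, h.adj_of_lt (by omega) (by omega)]
      omega
    · obtain ⟨k, hk, hk', rfl⟩ := (p3 _).1 hy
      have hz := (r3 _).1 hz
      subst hz
      exact ⟨(hx k).symm, fun hh => hout k hk hk' hh.symm⟩

theorem theta_free (h : ShortestHole G ℓ n C) {x : V} (hx : ∀ i, x ≠ C i) {a D : ℤ}
    (hD : (ℓ : ℤ) ≤ D + 2) (hD' : (ℓ : ℤ) ≤ n - D + 2)
    (hadj : ∀ k, a ≤ k → k < a + n → (G.Adj x (C k) ↔ k = a ∨ k = a + D)) : False := by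
  have hlong := h.long
  have hsix := h.six_le
  obtain ⟨P₁, q1, q2, -, q3⟩ := h.exists_arc (s := a) (t := a + D) (by omega) (by omega) rfl rfl
  have hne : C a ≠ C (a + D) := h.ne_of_lt (by omega) (by omega)
  have hna : ¬ G.Adj (C a) (C (a + D)) := by
    rw [h.adj_of_lt (by omega) (by omega)]; omega
  obtain ⟨P₃, r1, r2, r3⟩ := exists_inducedPath_of_length_two (G := G) (x := x)
    ((hadj a le_rfl (by omega)).2 (Or.inl rfl)).symm
    ((hadj (a + D) (by omega) (by omega)).2 (Or.inr rfl)) hne hna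
  obtain ⟨P₂, p1, p2, -, p3⟩ := h.exists_co_arc (a := a) (D := D) (by omega) (by omega)
  refine h.no_theta ⟨_, _, P₁, P₂, P₃, hne, hna, q1, p1, r1, ?_, ?_, ?_, by omega, by omega,
    by omega⟩
  · intro z hz y hy
    obtain ⟨k, hk, hk', rfl⟩ := (p3 _).1 hy
    obtain ⟨l, hl, hl', rfl⟩ := (q3 _).1 hz
    refine ⟨h.ne_of_lt (by omega) (by omega), ?_⟩
    rw [h.adj_of_lt (by omega) (by omega)]
    omega
  · intro y hy z hz
    obtain ⟨k, hk, hk', rfl⟩ := (q3 _).1 hy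
    have hz := (r3 _).1 hz
    subst hz
    refine ⟨(hx k).symm, fun hh => ?_⟩
    have := (hadj k (by omega) (by omega)).1 hh.symm
    omega
  · intro y hy z hz
    obtain ⟨k, hk, hk', rfl⟩ := (p3 _).1 hy
    have hz := (r3 _).1 hz
    subst hz
    refine ⟨(hx k).symm, fun hh => ?_⟩
    have := (hadj k (by omega) (by omega)).1 hh.symm
    omega

theorem isLongHoleOn (h : ShortestHole G ℓ n C) (a : ℤ) :
    IsLongHoleOn G ℓ {v | ∃ k, a ≤ k ∧ k < a + n ∧ C k = v} := by
  have hlong := h.long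
  have hsix := h.six_le
  obtain ⟨u, c, c1, c2, c3⟩ := exists_hole_of_fun (G := G) (fun k : ℕ => C (a + k)) n.toNat
    (by omega) (fun i j hij hj => h.ne_of_lt (by omega) (by omega))
    (fun i j hij hj => (h.adj_of_lt (by omega) (by omega)).trans (by omega))
  refine ⟨u, c, c1, by omega, ?_⟩
  ext v
  refine (c3 v).trans ?_
  constructor
  · rintro ⟨k, hk, rfl⟩; exact ⟨a + k, by omega, by omega, rfl⟩
  · rintro ⟨k, hk, hk', rfl⟩
    exact ⟨(k - a).toNat, by omega, by congr 1; omega⟩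

theorem prism_free (h : ShortestHole G ℓ n C) {x : V} (hx : ∀ i, x ≠ C i) {a D : ℤ}
    (hD : (ℓ : ℤ) ≤ D + 2) (hD' : (ℓ : ℤ) ≤ n - D)
    (hadj : ∀ k, a - 1 ≤ k → k < a - 1 + n →
      (G.Adj x (C k) ↔ k = a - 1 ∨ k = a ∨ k = a + D ∨ k = a + D + 1)) : False := by
  have hlong := h.long
  have hsix := h.six_le
  obtain ⟨P₁, q1, q2, q3, -⟩ := h.exists_arc (s := a) (t := a + D) (by omega) (by omega) rfl rfl
  obtain ⟨P₂', p1, p2, p3, -⟩ := h.exists_arc (s := a + D + 1) (t := a - 1 + n) (by omega)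
    (by omega) rfl (h.add_period (a - 1))
  obtain ⟨P₂, hP₂⟩ : ∃ P₂ : G.Walk (C (a - 1)) (C (a + D + 1)), P₂ = P₂'.reverse := ⟨_, rfl⟩
  have s2 : P₂.IsPath := by rw [hP₂]; exact p1.1.reverse
  have s3 : ∀ v, v ∈ P₂.support ↔ ∃ k, a + D + 1 ≤ k ∧ k ≤ a - 1 + n ∧ C k = v := by
    intro v; rw [hP₂, Walk.support_reverse, List.mem_reverse, p3]
  have A : ∀ k, (k = a - 1 ∨ k = a ∨ k = a + D ∨ k = a + D + 1) → G.Adj x (C k) := fun k hk =>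
    (hadj k (by omega) (by omega)).2 hk
  have A1 := A a (by omega)
  have A2 := A (a - 1) (by omega)
  have B1 := A (a + D) (by omega)
  have B2 := A (a + D + 1) (by omega)
  have A12 : G.Adj (C a) (C (a - 1)) := by
    have := (h.adj_succ (a - 1)).symm
    rwa [sub_add_cancel] at this
  have B12 : G.Adj (C (a + D)) (C (a + D + 1)) := h.adj_succ _
  have dis01 : x ∉ P₁.support := fun hh => by
    obtain ⟨k, -, -, hk⟩ := (q3 _).1 hh; exact hx k hk.symm
  have dis02 : x ∉ P₂.support := fun hh => by
    obtain ⟨k, -, -, hk⟩ := (s3 _).1 hh; exact hx k hk.symm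
  have dis12 : ∀ v, v ∈ P₁.support → v ∉ P₂.support := fun v hv hv' => by
    obtain ⟨k, hk1, hk2, rfl⟩ := (q3 _).1 hv
    obtain ⟨l, hl1, hl2, hl⟩ := (s3 _).1 hv'
    exact h.ne_of_lt (i := k) (j := l) (by omega) (by omega) hl.symm
  have hole01 : IsLongHoleOn G ℓ ({v | v = x} ∪ {v | v ∈ P₁.support}) := by
    obtain ⟨u, c, c1, c2, c3⟩ := h.exists_gap_hole hx (a := a) (L := D) (by omega) (by omega) A1 B1
      (fun k hk hk' hh => by have := (hadj k (by omega) (by omega)).1 hh; omega)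
    refine ⟨u, c, c1, by omega, ?_⟩
    ext v
    simp only [Set.mem_ofPred_eq, Set.mem_union, c3, q3]
  have hole02 : IsLongHoleOn G ℓ ({v | v = x} ∪ {v | v ∈ P₂.support}) := by
    have hend : C (a + D + 1 + (n - D - 2)) = C (a - 1) := by
      rw [← h.add_period (a - 1)]; congr 1; ring
    obtain ⟨u, c, c1, c2, c3⟩ := h.exists_gap_hole hx (a := a + D + 1) (L := n - D - 2) (by omega)
      (by omega) B2 (by rw [hend]; exact A2)
      (fun k hk hk' hh => by have := (hadj k (by omega) (by omega)).1 hh; omega)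
    refine ⟨u, c, c1, by omega, ?_⟩
    ext v
    simp only [Set.mem_ofPred_eq, Set.mem_union, c3, s3]
    rw [show a + D + 1 + (n - D - 2) = a - 1 + n by ring]
  have hole12 : IsLongHoleOn G ℓ ({v | v ∈ P₁.support} ∪ {v | v ∈ P₂.support}) := by
    have := h.isLongHoleOn a
    convert this using 1
    ext v
    simp only [Set.mem_ofPred_eq, Set.mem_union, q3, s3]
    constructor
    · rintro (⟨k, hk, hk', rfl⟩ | ⟨k, hk, hk', rfl⟩)
      · exact ⟨k, by omega, by omega, rfl⟩
      · exact ⟨k, by omega, by omega, rfl⟩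
    · rintro ⟨k, hk, hk', rfl⟩
      rcases le_or_gt k (a + D) with hle | hgt
      · exact Or.inl ⟨k, by omega, by omega, rfl⟩
      · exact Or.inr ⟨k, by omega, by omega, rfl⟩
  have hvx : vset (Walk.nil : G.Walk x x) = {v | v = x} := by
    ext v; simp [vset]
  refine h.no_prism ⟨![x, C a, C (a - 1)], ![x, C (a + D), C (a + D + 1)],
    fun i => match i with
      | 0 => (Walk.nil : G.Walk x x)
      | 1 => P₁
      | 2 => P₂, ?_, ?_, ?_, ?_, ?_, ?_⟩
  · intro i j hij
    fin_cases i <;> fin_cases j <;>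
      first
      | exact absurd rfl hij
      | exact A1
      | exact A2
      | exact A1.symm
      | exact A2.symm
      | exact A12
      | exact A12.symm
  · intro i j hij
    fin_cases i <;> fin_cases j <;>
      first
      | exact absurd rfl hij
      | exact B1
      | exact B2
      | exact B1.symm
      | exact B2.symm
      | exact B12
      | exact B12.symm
  · have : Set.range ![x, C a, C (a - 1)] ∩ Set.range ![x, C (a + D), C (a + D + 1)] ⊆ {x} := by
      rintro v ⟨⟨i, rfl⟩, ⟨j, hj⟩⟩
      have n1 : C a ≠ C (a + D) := h.ne_of_lt (by omega) (by omega)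
      have n2 : C a ≠ C (a + D + 1) := h.ne_of_lt (by omega) (by omega)
      have n3 : C (a - 1) ≠ C (a + D) := h.ne_of_lt (by omega) (by omega)
      have n4 : C (a - 1) ≠ C (a + D + 1) := h.ne_of_lt (by omega) (by omega)
      fin_cases i
      · rfl
      · fin_cases j
        · exact absurd hj (hx a)
        · exact absurd hj.symm n1
        · exact absurd hj.symm n2
      · fin_cases j
        · exact absurd hj (hx _)
        · exact absurd hj.symm n3
        · exact absurd hj.symm n4
    exact Set.subsingleton_singleton.anti this
  · intro i
    fin_cases i
    · exact Walk.IsPath.nil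
    · exact q1.1
    · exact s2
  · intro i j hij v hv hv'
    fin_cases i <;> fin_cases j
    · exact hij rfl
    · obtain rfl : v = x := by simpa using hv
      exact dis01 hv'
    · obtain rfl : v = x := by simpa using hv
      exact dis02 hv'
    · obtain rfl : v = x := by simpa using hv'
      exact dis01 hv
    · exact hij rfl
    · exact dis12 v hv hv'
    · obtain rfl : v = x := by simpa using hv'
      exact dis02 hv
    · exact dis12 v hv' hv
    · exact hij rfl
  · intro i j hij
    fin_cases i <;> fin_cases j
    · exact absurd rfl hij
    · rw [← hvx] at hole01; exact hole01
    · rw [← hvx] at hole02; exact hole02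
    · rw [← hvx, Set.union_comm] at hole01; exact hole01
    · exact absurd rfl hij
    · exact hole12
    · rw [← hvx, Set.union_comm] at hole02; exact hole02
    · rw [Set.union_comm] at hole12; exact hole12
    · exact absurd rfl hij

end ShortestHole

theorem Major.gap_le {V : Type*} {G : SimpleGraph V} {n : ℤ} {C : ℤ → V} {x : V}
    (h : Major G n C x) {a L : ℤ} (h3 : ∀ k, a < k → k < a + L → ¬ G.Adj x (C k)) :
    L ≤ n - 3 := by
  obtain ⟨k, h1, h2, hk⟩ := h.2 (a - 1)
  by_contra hcon
  exact h3 k (by omega) (by omega) hk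

namespace ShortestHole

variable {V : Type*} {G : SimpleGraph V} {ℓ : ℕ} {n : ℤ} {C : ℤ → V}

/-- The complement of a gap of `x` contains a neighbour of `x` far from its ends. -/
theorem exists_adj_far (h : ShortestHole G ℓ n C) {x : V} (hx : Major G n C x) {L K : ℤ}
    (hL : 2 ≤ L) (hK : L + K = n) (h1 : G.Adj x (C (-L))) (h2 : G.Adj x (C 0))
    (h3 : ∀ k, -L < k → k < 0 → ¬ G.Adj x (C k)) :
    ∃ k, 2 ≤ k ∧ k ≤ K - 2 ∧ G.Adj x (C k) := by
  by_contra hcon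
  push Not at hcon
  have hlong := h.long
  have hsix := h.six_le
  have hev := h.even_length
  have hevl := h.even_bound
  have hxC := hx.1
  have hLn : L ≤ n - 3 := hx.gap_le (a := -L) (fun k hk hk' => h3 k hk (by omega))
  have hgL := h.odd_gap hxC (a := -L) hL hLn h1 (by simpa using h2)
    (fun k hk hk' => h3 k hk (by omega))
  have eK : C K = C (-L) := by rw [← h.add_period (-L)]; congr 1; omega
  have h1' : G.Adj x (C K) := by rwa [eK]
  have e0 : C n = C 0 := by rw [← h.add_period 0, zero_add]
  have e1 : C (n + 1) = C 1 := by rw [← h.add_period 1, add_comm]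
  have nb0 : ∀ k, -L ≤ k → k < K → G.Adj x (C k) →
      k = -L ∨ k = 0 ∨ (k = 1 ∧ G.Adj x (C 1)) ∨ (k = K - 1 ∧ G.Adj x (C (K - 1))) := by
    intro k hk hk' hadj
    by_contra hne
    push Not at hne
    by_cases hk1 : k = 1
    · subst hk1; exact hne.2.2.1 rfl hadj
    by_cases hk2 : k = K - 1
    · subst hk2; exact hne.2.2.2 rfl hadj
    rcases lt_trichotomy k 0 with hlt | heq | hlt
    · exact h3 k (by omega) hlt hadj
    · exact hne.2.1 heq
    · exact hcon k (by omega) (by omega) hadj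
  have nb : ∀ k, -L ≤ k → k < K + n → G.Adj x (C k) →
      k = -L ∨ k = 0 ∨ (k = 1 ∧ G.Adj x (C 1)) ∨ (k = K - 1 ∧ G.Adj x (C (K - 1))) ∨
      k = K ∨ k = n ∨ (k = n + 1 ∧ G.Adj x (C 1)) ∨ (k = n + K - 1 ∧ G.Adj x (C (K - 1))) := by
    intro k hk hk' hadj
    rcases lt_or_ge k K with hlt | hge
    · have := nb0 k hk hlt hadj
      tauto
    · have := nb0 (k - n) (by omega) (by omega) (by rwa [h.sub_period])
      rcases this with hh | hh | ⟨hh, hh'⟩ | ⟨hh, hh'⟩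
      · omega
      · omega
      · exact Or.inr (Or.inr (Or.inr (Or.inr (Or.inr (Or.inr (Or.inl ⟨by omega, hh'⟩))))))
      · exact Or.inr (Or.inr (Or.inr (Or.inr (Or.inr (Or.inr (Or.inr ⟨by omega, hh'⟩))))))
  clear nb0
  have jewelK : K % 2 = 1 → K ≤ ℓ → False := by
    intro hodd hle
    refine h.jewel_free hxC (a := 0) (D := K) hodd (by omega) hle h2 (by simpa using h1') ?_
    intro k hk hk' hadj
    have := nb k (by omega) (by omega) hadj
    omega
  by_cases A1 : G.Adj x (C 1) <;> by_cases AK : G.Adj x (C (K - 1)) <;>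
    simp only [A1, AK, and_true, and_false, false_or, or_false] at nb
  · rcases Int.emod_two_eq_zero_or_one L with hpar | hpar
    · have := h.odd_gap hxC (a := 1) (L := K - 2) (by omega) (by omega) A1
        (by rwa [show 1 + (K - 2) = K - 1 by ring])
        (fun k hk hk' hadj => by have := nb k (by omega) (by omega) hadj; omega)
      omega
    · by_cases hKl : K ≤ ℓ
      · exact jewelK (by omega) hKl
      by_cases hLl : L + 2 ≤ ℓ
      · refine h.jewel_free hxC (a := K - 1) (D := L + 2) (by omega) (by omega) hLl AK
          (by rwa [show K - 1 + (L + 2) = n + 1 by omega, e1]) ?_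
        intro k hk hk' hadj
        have := nb k (by omega) (by omega) hadj
        omega
      · refine h.prism_free hxC (a := 1) (D := K - 2) (by omega) (by omega) ?_
        intro k hk hk'
        constructor
        · intro hadj
          have := nb k (by omega) (by omega) hadj
          omega
        · intro hh
          have : k = 0 ∨ k = 1 ∨ k = K - 1 ∨ k = K := by omega
          rcases this with rfl | rfl | rfl | rfl <;> assumption
  · rcases Int.emod_two_eq_zero_or_one L with hpar | hpar
    · refine h.jewel_free hxC (a := -L) (D := L + 1) (by omega) (by omega) (by omega) h1
          (by rwa [show -L + (L + 1) = 1 by omega]) ?_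
      intro k hk hk' hadj
      have := nb k (by omega) (by omega) hadj
      omega
    · have := h.odd_gap hxC (a := 1) (L := K - 1) (by omega) (by omega) A1
        (by rwa [show 1 + (K - 1) = K by ring])
        (fun k hk hk' hadj => by have := nb k (by omega) (by omega) hadj; omega)
      exact jewelK (by omega) (by omega)
  · rcases Int.emod_two_eq_zero_or_one L with hpar | hpar
    · refine h.jewel_free hxC (a := K - 1) (D := L + 1) (by omega) (by omega) (by omega) AK
          (by rwa [show K - 1 + (L + 1) = n by omega, e0]) ?_
      intro k hk hk' hadj
      have := nb k (by omega) (by omega) hadj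
      omega
    · have := h.odd_gap hxC (a := 0) (L := K - 1) (by omega) (by omega) h2
        (by rwa [zero_add])
        (fun k hk hk' hadj => by have := nb k (by omega) (by omega) hadj; omega)
      exact jewelK (by omega) (by omega)
  · have hKn : K ≤ n - 3 := hx.gap_le (a := 0) (fun k hk hk' hadj => by
      have := nb k (by omega) (by omega) hadj
      omega)
    have hgK := h.odd_gap hxC (a := 0) (L := K) (by omega) (by omega) h2 (by rwa [zero_add])
        (fun k hk hk' hadj => by have := nb k (by omega) (by omega) hadj; omega)
    by_cases hth : (ℓ : ℤ) ≤ K + 2 ∧ (ℓ : ℤ) ≤ L + 2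
    · refine h.theta_free hxC (a := -L) (D := L) (by omega) (by omega) ?_
      intro k hk hk'
      constructor
      · intro hadj
        have := nb k (by omega) (by omega) hadj
        omega
      · intro hh
        have : k = 0 ∨ k = -L := by omega
        rcases this with rfl | rfl <;> assumption
    · rcases Int.emod_two_eq_zero_or_one L with hpar | hpar
      · omega
      · by_cases hKl : K + 2 < ℓ
        · exact jewelK (by omega) (by omega)
        · refine h.jewel_free hxC (a := -L) (D := L) (by omega) (by omega) (by omega) h1
            (by rwa [neg_add_cancel]) ?_
          intro k hk hk' hadj
          have := nb k (by omega) (by omega) hadj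
          omega

end ShortestHole

theorem exists_least_int {P : ℤ → Prop} {a b : ℤ} (h : ∃ k, a ≤ k ∧ k ≤ b ∧ P k) :
    ∃ k, a ≤ k ∧ k ≤ b ∧ P k ∧ ∀ j, a ≤ j → j < k → ¬ P j := by
  obtain ⟨k, ⟨h1, h2, h3⟩, h4⟩ := Int.exists_least_of_bdd (P := fun k => a ≤ k ∧ k ≤ b ∧ P k)
    ⟨a, fun z hz => hz.1⟩ h
  refine ⟨k, h1, h2, h3, fun j hj hj' hP => ?_⟩
  have := h4 j ⟨hj, by omega, hP⟩
  omega

theorem exists_greatest_int {P : ℤ → Prop} {a b : ℤ} (h : ∃ k, a ≤ k ∧ k ≤ b ∧ P k) :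
    ∃ k, a ≤ k ∧ k ≤ b ∧ P k ∧ ∀ j, k < j → j ≤ b → ¬ P j := by
  obtain ⟨k, ⟨h1, h2, h3⟩, h4⟩ := Int.exists_greatest_of_bdd (P := fun k => a ≤ k ∧ k ≤ b ∧ P k)
    ⟨b, fun z hz => hz.2.1⟩ h
  refine ⟨k, h1, h2, h3, fun j hj hj' hP => ?_⟩
  have := h4 j ⟨by omega, hj', hP⟩
  omega

theorem exists_closest_int {P Q : ℤ → Prop} {a b : ℤ} (hP : ∃ k, a ≤ k ∧ k ≤ b ∧ P k)
    (hQ : ∃ k, a ≤ k ∧ k ≤ b ∧ Q k) :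
    ∃ i j, a ≤ i ∧ i ≤ b ∧ a ≤ j ∧ j ≤ b ∧ P i ∧ Q j ∧
      ∀ k, min i j ≤ k → k ≤ max i j → (P k → k = i) ∧ (Q k → k = j) := by
  obtain ⟨i₁, h1, h2, h3⟩ := hP
  obtain ⟨j₁, h4, h5, h6⟩ := hQ
  obtain ⟨d, ⟨i, j, hi, hi', hj, hj', hPi, hQj, hd⟩, hmin⟩ :=
    Int.exists_least_of_bdd (P := fun d => ∃ i j, a ≤ i ∧ i ≤ b ∧ a ≤ j ∧ j ≤ b ∧ P i ∧ Q j ∧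
      max i j - min i j = d) ⟨0, by rintro z ⟨i, j, -, -, -, -, -, -, h⟩; omega⟩
      ⟨_, i₁, j₁, h1, h2, h4, h5, h3, h6, rfl⟩
  refine ⟨i, j, hi, hi', hj, hj', hPi, hQj, fun k hk hk' => ⟨fun hPk => ?_, fun hQk => ?_⟩⟩
  · have := hmin _ ⟨k, j, by omega, by omega, hj, hj', hPk, hQj, rfl⟩
    omega
  · have := hmin _ ⟨i, k, hi, hi', by omega, by omega, hPi, hQk, rfl⟩
    omega

namespace ShortestHole

variable {V : Type*} {G : SimpleGraph V} {ℓ : ℕ} {n : ℤ} {C : ℤ → V}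

/-- A major vertex with a neighbour in a gap of `x`, but none near its ends, has exactly two
neighbours in that gap, and these are consecutive. -/
theorem exists_consecutive_adj (h : ShortestHole G ℓ n C) {x z : V} (hx : Major G n C x)
    (hz : Major G n C z) (hxz : x ≠ z) (hnxz : ¬ G.Adj x z) {L K : ℤ}
    (hL : 2 ≤ L) (hK : L + K = n) (h1 : G.Adj x (C (-L))) (h2 : G.Adj x (C 0))
    (h3 : ∀ k, -L < k → k < 0 → ¬ G.Adj x (C k))
    (hz1 : ∀ k : ℤ, -ℓ + 5 ≤ k → k ≤ 1 → ¬ G.Adj z (C k))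
    (hz2 : ∀ k : ℤ, -L - 1 ≤ k → k ≤ -L + ℓ - 5 → ¬ G.Adj z (C k))
    (hzP : ∃ k, -L ≤ k ∧ k ≤ 0 ∧ G.Adj z (C k)) :
    L % 2 = 1 ∧ (∃ t : ℤ, ℓ - 4 ≤ t ∧ t + 1 ≤ L - (ℓ - 4) ∧
      (∀ k, -L ≤ k → k ≤ 0 → (G.Adj z (C k) ↔ k = -t ∨ k = -t - 1))) ∧
      ∃ k, 2 ≤ k ∧ k ≤ K - 2 ∧ G.Adj z (C k) := by
  have hlong := h.long
  have hsix := h.six_le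
  have hev := h.even_length
  have hevl := h.even_bound
  have hLn : L ≤ n - 3 := hx.gap_le (a := -L) (fun k hk hk' => h3 k hk (by omega))
  have hgL := h.odd_gap hx.1 (a := -L) hL hLn h1 (by simpa using h2)
    (fun k hk hk' => h3 k hk (by omega))
  obtain ⟨r', hr1', hr2', hr3', hr4'⟩ := exists_least_int hzP
  obtain ⟨r, hr1, hr2, hr3, hr4⟩ := exists_greatest_int hzP
  have hrr : r' ≤ r := by
    by_contra hlt
    exact hr4 r' (by omega) hr2' hr3'
  have hrb : r ≤ -(ℓ - 4) := by
    by_contra hlt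
    exact hz1 r (by omega) (by omega) hr3
  have hrb' : -L + (ℓ - 4) ≤ r' := by
    by_contra hlt
    exact hz2 r' (by omega) (by omega) hr3'
  have eK : C K = C (-L) := by rw [← h.add_period (-L)]; congr 1; omega
  have h1' : G.Adj x (C K) := by rwa [eK]
  have outer : r + 2 ≤ r + (r - r') → L - (r - r') + 4 ≥ ℓ → (L - (r - r')) % 2 = 1 := by
    intro hge hlo
    have := h.two_routes hx.1 hz.1 hxz hnxz (-L) r' 0 r (by omega) (by omega) h1 hr3' h2 hr3
      (fun k hk hk' => ⟨fun hadj => by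
        by_contra hne; exact h3 k (by omega) (by omega) hadj,
        fun hadj => by by_contra hne; exact hr4' k (by omega) (by omega) hadj⟩)
      (fun k hk hk' => ⟨fun hadj => by
        by_contra hne; exact h3 k (by omega) (by omega) hadj,
        fun hadj => by by_contra hne; exact hr4 k (by omega) (by omega) hadj⟩)
    omega
  have far : ∃ k, 2 ≤ k ∧ k ≤ K - 2 ∧ G.Adj z (C k) := by
    by_contra hcon
    push Not at hcon
    have gap : ∀ k, r < k → k < r' + n → ¬ G.Adj z (C k) := by
      intro k hk hk' hadj
      rcases le_or_gt k 1 with hle | hgt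
      · rcases le_or_gt k 0 with hle' | hgt'
        · exact hr4 k hk hle' hadj
        · exact hz1 k (by omega) (by omega) hadj
      · rcases le_or_gt k (K - 2) with hle' | hgt'
        · exact hcon k (by omega) hle' hadj
        · rw [← h.sub_period] at hadj
          rcases le_or_gt (-L) (k - n) with hle'' | hgt''
          · exact hr4' (k - n) (by omega) (by omega) hadj
          · exact hz2 (k - n) (by omega) (by omega) hadj
    have hD := hz.gap_le (a := r) (L := n - (r - r')) (fun k hk hk' => gap k hk (by omega))
    have hgz := h.odd_gap hz.1 (a := r) (L := n - (r - r')) (by omega) hD hr3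
      (by rw [show r + (n - (r - r')) = r' + n by ring, h.add_period]; exact hr3')
      (fun k hk hk' => gap k hk (by omega))
    have := outer (by omega) (by omega)
    omega
  obtain ⟨i, j, hi, hi', hj, hj', hxi, hzj, hij⟩ :=
    exists_closest_int (h.exists_adj_far hx hL hK h1 h2 h3) far
  have near0 := h.two_routes hx.1 hz.1 hxz hnxz 0 r i j (by omega) (by omega) h2 hr3 hxi hzj
    (fun k hk hk' => ⟨fun hadj => by
        by_contra hne; exact h3 k (by omega) (by omega) hadj,
        fun hadj => by by_contra hne; exact hr4 k (by omega) (by omega) hadj⟩) hij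
  have nearL := h.two_routes hx.1 hz.1 hxz hnxz i j K (r' + n) (by omega) (by omega) hxi hzj h1'
    (by rwa [h.add_period]) hij
    (fun k hk hk' => ⟨fun hadj => by
        by_contra hne
        rw [← h.sub_period] at hadj
        exact h3 (k - n) (by omega) (by omega) hadj,
        fun hadj => by
        by_contra hne
        rw [← h.sub_period] at hadj
        exact hr4' (k - n) (by omega) (by omega) hadj⟩)
  have hr : r = r' + 1 := by
    by_contra hne
    rcases hrr.eq_or_lt with heq | hlt
    · omega
    · have := outer (by omega) (by omega)
      omega
  refine ⟨by omega, ⟨-r, by omega, by omega, fun k hk hk' => ⟨fun hadj => ?_, ?_⟩⟩, far⟩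
  · by_contra hne
    rcases lt_or_ge r k with hlt | hge
    · exact hr4 k hlt hk' hadj
    · exact hr4' k hk (by omega) hadj
  · rintro (rfl | rfl)
    · rwa [neg_neg]
    · rwa [neg_neg, hr, add_sub_cancel_right]

end ShortestHole

/-- `y` is a major vertex whose neighbours in the path `C (-L - 1), …, C 1` are precisely
`C (-s - 1)` and `C (-s)`, and whose first and last neighbours in the remainder of the hole are
`C f` and `C f'`. -/
structure ConsecutiveAdj {V : Type*} (G : SimpleGraph V) (ℓ : ℕ) (n : ℤ) (C : ℤ → V)
    (L : ℤ) (y : V) (s f f' : ℤ) : Prop where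
  major : Major G n C y
  lower : ℓ - 4 ≤ s
  upper : s + 1 ≤ L - (ℓ - 4)
  adj_iff : ∀ k, -L - 1 ≤ k → k ≤ 1 → (G.Adj y (C k) ↔ k = -s ∨ k = -s - 1)
  two_le : 2 ≤ f
  le : f ≤ f'
  last_le : f' ≤ n - L - 2
  adj_first : G.Adj y (C f)
  adj_last : G.Adj y (C f')
  first : ∀ k, 2 ≤ k → k < f → ¬ G.Adj y (C k)
  last : ∀ k, f' < k → k ≤ n - L - 2 → ¬ G.Adj y (C k)

namespace ConsecutiveAdj

variable {V : Type*} {G : SimpleGraph V} {ℓ : ℕ} {n : ℤ} {C : ℤ → V} {L : ℤ} {y : V} {s f f' : ℤ}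

theorem of_adj (d : ConsecutiveAdj G ℓ n C L y s f f') {k : ℤ} (h1 : -L - 1 ≤ k)
    (h2 : k ≤ n - L - 2) (h : G.Adj y (C k)) : k = -s ∨ k = -s - 1 ∨ (f ≤ k ∧ k ≤ f') := by
  rcases le_or_gt k 1 with hle | hgt
  · rcases (d.adj_iff k h1 hle).1 h with hk | hk
    · exact Or.inl hk
    · exact Or.inr (Or.inl hk)
  · refine Or.inr (Or.inr ⟨?_, ?_⟩)
    · by_contra hlt; exact d.first k (by omega) (by omega) h
    · by_contra hlt; exact d.last k (by omega) (by omega) h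

theorem adj_pair (hsix : 6 ≤ ℓ) (d : ConsecutiveAdj G ℓ n C L y s f f') :
    G.Adj y (C (-s)) ∧ G.Adj y (C (-s - 1)) := by
  have h1 := d.lower
  have h2 := d.upper
  exact ⟨(d.adj_iff _ (by omega) (by omega)).2 (Or.inl rfl),
    (d.adj_iff _ (by omega) (by omega)).2 (Or.inr rfl)⟩

theorem parity (h : ShortestHole G ℓ n C) (d : ConsecutiveAdj G ℓ n C L y s f f') :
    (s + f) % 2 = 1 ∧ (s + f') % 2 = 0 ∧ f' ≠ f + 1 := by
  have hlong := h.long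
  have hsix := h.six_le
  have hev := h.even_length
  have hevl := h.even_bound
  have h1 := d.lower
  have h2 := d.upper
  have h3 := d.two_le
  have h4 := d.le
  have h5 := d.last_le
  obtain ⟨a1, a2⟩ := d.adj_pair hsix
  have gapF : ∀ k, -s < k → k < f → ¬ G.Adj y (C k) := fun k hk hk' hadj => by
    have := d.of_adj (by omega) (by omega) hadj
    omega
  have gapL : ∀ k, f' < k → k < n - s - 1 → ¬ G.Adj y (C k) := fun k hk hk' hadj => by
    rcases le_or_gt k (n - L - 2) with hle | hgt
    · have := d.of_adj (by omega) (by omega) hadj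
      omega
    · rw [← h.sub_period] at hadj
      have := d.of_adj (by omega) (by omega) hadj
      omega
  have e : C (f' + (n - s - 1 - f')) = C (-s - 1) := by
    rw [← h.add_period (-s - 1)]; congr 1; ring
  have p1 := d.major.gap_le (a := -s) (L := s + f) (fun k hk hk' => gapF k hk (by omega))
  have p2 := h.odd_gap d.major.1 (a := -s) (L := s + f) (by omega) p1 a1
    (by rw [neg_add_cancel_left]; exact d.adj_first) (fun k hk hk' => gapF k hk (by omega))
  have q1 := d.major.gap_le (a := f') (L := n - s - 1 - f')
    (fun k hk hk' => gapL k hk (by omega))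
  have q2 := h.odd_gap d.major.1 (a := f') (L := n - s - 1 - f') (by omega) q1 d.adj_last
    (by rw [e]; exact a2) (fun k hk hk' => gapL k hk (by omega))
  refine ⟨by omega, by omega, ?_⟩
  rintro rfl
  refine h.prism_free d.major.1 (a := -s) (D := s + f) (by omega) (by omega) ?_
  intro k hk hk'
  constructor
  · intro hadj
    rcases le_or_gt k (n - L - 2) with hle | hgt
    · have := d.of_adj (by omega) (by omega) hadj
      omega
    · rw [← h.sub_period] at hadj
      have := d.of_adj (by omega) (by omega) hadj
      omega
  · intro hh
    have : k = -s - 1 ∨ k = -s ∨ k = f ∨ k = f + 1 := by omega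
    have b1 := d.adj_first
    have b2 := d.adj_last
    rcases this with rfl | rfl | rfl | rfl <;> assumption

/-- Two nonadjacent such vertices have a neighbour of one close to a neighbour of the other. -/
theorem hit (h : ShortestHole G ℓ n C) (d : ConsecutiveAdj G ℓ n C L y s f f') {z : V}
    {t g g' : ℤ} (d' : ConsecutiveAdj G ℓ n C L z t g g') (hyz : y ≠ z) (hnyz : ¬ G.Adj y z)
    (hgf : g ≤ f) (hv : ∀ k : ℤ, -s - 1 ≤ k → k ≤ -s + ℓ - 5 → ¬ G.Adj z (C k))
    (hf : ∀ k : ℤ, f - ℓ + 5 ≤ k → k ≤ f + 1 → ¬ G.Adj z (C k)) : False := by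
  have hlong := h.long
  have hsix := h.six_le
  have hev := h.even_length
  have hevl := h.even_bound
  have s1 := d.lower
  have s2 := d.upper
  have f1 := d.two_le
  have f2 := d.le
  have f3 := d.last_le
  have t1 := d'.lower
  have t2 := d'.upper
  have g1 := d'.two_le
  have g2 := d'.le
  have g3 := d'.last_le
  obtain ⟨y1, y2⟩ := d.adj_pair hsix
  obtain ⟨z1, z2⟩ := d'.adj_pair hsix
  obtain ⟨ps, ps', pn⟩ := d.parity h
  obtain ⟨pt, pt', -⟩ := d'.parity h
  have hgf' : g < f := by
    refine lt_of_le_of_ne hgf ?_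
    rintro rfl
    exact hf g (by omega) (by omega) d'.adj_first
  have hts : t ≥ s + 2 ∨ t ≤ s - ℓ + 3 := by
    by_contra hcon
    by_cases hle : t ≤ s + 1 ∧ s - ℓ + 5 ≤ t
    · exact hv (-t) (by omega) (by omega) z1
    · exact hv (-t - 1) (by omega) (by omega) z2
  obtain ⟨b, b1, b2, b3, b4⟩ := exists_greatest_int (P := fun k => G.Adj z (C k)) (a := 2) (b := f)
    ⟨g, by omega, by omega, d'.adj_first⟩
  have hb : b ≤ f - ℓ + 4 := by
    by_contra hlt
    exact hf b (by omega) (by omega) b3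
  have hgb : g ≤ b := by
    by_contra hlt
    exact d'.first b b1 (by omega) b3
  have mid : ∀ k, min f b ≤ k → k ≤ max f b →
      (G.Adj y (C k) → k = f) ∧ (G.Adj z (C k) → k = b) := fun k hk hk' =>
    ⟨fun hadj => by
      have := d.of_adj (by omega) (by omega) hadj
      omega, fun hadj => by
      by_contra hne
      exact b4 k (by omega) (by omega) hadj⟩
  obtain ⟨i, i', hsame, hle, hge, hyi, hzi, hii⟩ : ∃ i i',
      max i i' - min i i' = max (s - t) (t - s) - 1 ∧ -L < min i i' ∧ max i i' < 0 ∧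
      G.Adj y (C i) ∧ G.Adj z (C i') ∧ (∀ k, min i i' ≤ k → k ≤ max i i' →
      (G.Adj y (C k) → k = i) ∧ (G.Adj z (C k) → k = i')) := by
    rcases hts with hts | hts
    · refine ⟨-s - 1, -t, by omega, by omega, by omega, y2, z1, fun k hk hk' =>
        ⟨fun hadj => ?_, fun hadj => ?_⟩⟩
      · have := d.of_adj (by omega) (by omega) hadj
        omega
      · have := d'.of_adj (by omega) (by omega) hadj
        omega
    · refine ⟨-s, -t - 1, by omega, by omega, by omega, y1, z2, fun k hk hk' =>
        ⟨fun hadj => ?_, fun hadj => ?_⟩⟩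
      · have := d.of_adj (by omega) (by omega) hadj
        omega
      · have := d'.of_adj (by omega) (by omega) hadj
        omega
  have route1 := h.two_routes d.major.1 d'.major.1 hyz hnyz i i' f b (by omega) (by omega)
    hyi hzi d.adj_first b3 hii mid
  have hg' : f + 2 ≤ g' := by
    by_contra hlt
    rcases le_or_gt g' f with hle | hgt
    · have hgb' : g' = b := by
        by_contra hne
        rcases lt_or_gt_of_ne hne with hlt' | hgt'
        · exact d'.last b hlt' (by omega) b3
        · exact b4 g' hgt' hle d'.adj_last
      omega
    · exact hf g' (by omega) (by omega) d'.adj_last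
  obtain ⟨p, q, hp, hp', hq, hq', hyp, hzq, hpq⟩ := exists_closest_int
    (P := fun k => G.Adj y (C k)) (Q := fun k => G.Adj z (C k)) (a := f + 2) (b := n - L - 2)
    ⟨f', by omega, by omega, d.adj_last⟩ ⟨g', by omega, by omega, d'.adj_last⟩
  have route2 := h.two_routes d.major.1 d'.major.1 hyz hnyz f b p q (by omega) (by omega)
    d.adj_first b3 hyp hzq mid hpq
  rcases hts with hts | hts
  · have route3 := h.two_routes d.major.1 d'.major.1 hyz hnyz (-s) g p q (by omega) (by omega)
      y1 d'.adj_first hyp hzq (fun k hk hk' => ⟨fun hadj => by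
        have := d.of_adj (by omega) (by omega) hadj
        omega, fun hadj => by
        have := d'.of_adj (by omega) (by omega) hadj
        omega⟩) hpq
    omega
  · have route3 := h.two_routes d.major.1 d'.major.1 hyz hnyz i i' p q (by omega) (by omega)
      hyi hzi hyp hzq hii hpq
    omega

end ConsecutiveAdj

/-- `v` is an interior vertex of one of the given paths `C a, …, C (a + l)` of the hole. -/
def InteriorOfArc {V : Type*} (C : ℤ → V) (arcs : List (ℤ × ℕ)) (v : V) : Prop :=
  ∃ p ∈ arcs, ∃ k, p.1 < k ∧ k < p.1 + p.2 ∧ C k = v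

/-- Two paths `C a, …, C (a + l)` of the hole are anticomplete. -/
def AnticompleteArcs {V : Type*} (G : SimpleGraph V) (C : ℤ → V) (p q : ℤ × ℕ) : Prop :=
  ∀ k k', p.1 ≤ k → k ≤ p.1 + p.2 → q.1 ≤ k' → k' ≤ q.1 + q.2 →
    C k ≠ C k' ∧ ¬ G.Adj (C k) (C k')

theorem AnticompleteArcs.symm {V : Type*} {G : SimpleGraph V} {C : ℤ → V} {p q : ℤ × ℕ}
    (h : AnticompleteArcs G C p q) : AnticompleteArcs G C q p := fun k k' h1 h2 h3 h4 =>
  ⟨(h k' k h3 h4 h1 h2).1.symm, fun hadj => (h k' k h3 h4 h1 h2).2 hadj.symm⟩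

/-- Paths of a hole that are not anticomplete are covered by a path of no greater cost. -/
theorem CyclicHole.exists_merge {V : Type*} {G : SimpleGraph V} {n : ℤ} {C : ℤ → V}
    (h : CyclicHole G n C) {p q : ℤ × ℕ} (hpq : ¬ AnticompleteArcs G C p q) :
    ∃ m : ℤ × ℕ, m.2 + 1 ≤ (p.2 + 1) + (q.2 + 1) ∧
      ∀ v, InteriorOfArc C [p, q] v → InteriorOfArc C [m] v := by
  have hw : ∃ w : ℤ, q.1 + n * w - p.1 ≤ p.2 + 1 ∧ p.1 - (q.1 + n * w) ≤ q.2 + 1 := by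
    by_contra hcon
    push Not at hcon
    refine hpq fun k k' h1 h2 h3 h4 => ⟨?_, ?_⟩
    · rw [Ne, h.eq_iff]
      rintro ⟨w, hw⟩
      have := hcon w (by omega)
      omega
    · rw [h.adj_iff]
      rintro (⟨w, hw⟩ | ⟨w, hw⟩)
      · have := hcon w (by omega)
        omega
      · have := hcon w (by omega)
        omega
  obtain ⟨w, hw1, hw2⟩ := hw
  have hper : ∀ k, C (k + n * w) = C k := fun k => (h.eq_iff _ _).2 ⟨w, by ring⟩
  rcases le_total p.1 (q.1 + n * w) with hle | hle
  · refine ⟨(p.1, max p.2 (q.1 + n * w - p.1 + q.2).toNat), by dsimp only; omega, ?_⟩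
    rintro v ⟨r, hr, k, hk, hk', rfl⟩
    simp only [List.mem_cons, List.not_mem_nil, or_false] at hr
    rcases hr with rfl | rfl
    · exact ⟨_, List.mem_singleton_self _, k, hk, by dsimp only; omega, rfl⟩
    · exact ⟨_, List.mem_singleton_self _, k + n * w, by dsimp only; omega, by dsimp only; omega,
        hper k⟩
  · refine ⟨(q.1 + n * w, max q.2 (p.1 - (q.1 + n * w) + p.2).toNat), by dsimp only; omega, ?_⟩
    rintro v ⟨r, hr, k, hk, hk', rfl⟩
    simp only [List.mem_cons, List.not_mem_nil, or_false] at hr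
    rcases hr with rfl | rfl
    · exact ⟨_, List.mem_singleton_self _, k, by dsimp only; omega, by dsimp only; omega, rfl⟩
    · exact ⟨_, List.mem_singleton_self _, k + n * w, by dsimp only; omega, by dsimp only; omega,
        hper k⟩

/-- Any family of paths of a hole is covered by a pairwise anticomplete family of no greater
cost. -/
theorem CyclicHole.exists_pairwise_arcs {V : Type*} {G : SimpleGraph V} {n : ℤ} {C : ℤ → V}
    (h : CyclicHole G n C) (arcs : List (ℤ × ℕ)) :
    ∃ arcs' : List (ℤ × ℕ), arcs'.length ≤ arcs.length ∧ arcs'.Pairwise (AnticompleteArcs G C) ∧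
      (arcs'.map fun p => p.2 + 1).sum ≤ (arcs.map fun p => p.2 + 1).sum ∧
      ∀ v, InteriorOfArc C arcs v → InteriorOfArc C arcs' v := by
  obtain ⟨N, hN⟩ : ∃ N, N = arcs.length := ⟨_, rfl⟩
  induction N using Nat.strong_induction_on generalizing arcs with
  | _ N ih =>
    subst hN
    rcases arcs with _ | ⟨p, rest⟩
    · exact ⟨[], le_rfl, List.Pairwise.nil, le_rfl, fun v hv => hv⟩
    obtain ⟨rest', r1, r2, r3, r4⟩ := ih rest.length (by simp) rest rfl
    by_cases hR : ∀ q ∈ rest', AnticompleteArcs G C p q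
    · refine ⟨p :: rest', by simpa using r1, List.pairwise_cons.2 ⟨hR, r2⟩, by simpa using r3, ?_⟩
      rintro v ⟨q, hq, hk⟩
      rcases List.mem_cons.1 hq with rfl | hq
      · exact ⟨q, List.mem_cons_self, hk⟩
      · obtain ⟨q', hq', hk'⟩ := r4 v ⟨q, hq, hk⟩
        exact ⟨q', List.mem_cons_of_mem _ hq', hk'⟩
    · push Not at hR
      obtain ⟨q, hq, hpq⟩ := hR
      obtain ⟨m, m1, m2⟩ := h.exists_merge hpq
      have hperm := List.perm_cons_erase hq
      have hlen := hperm.length_eq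
      have hsum := (hperm.map fun p : ℤ × ℕ => p.2 + 1).sum_eq
      simp only [List.length_cons] at hlen
      simp only [List.map_cons, List.sum_cons] at hsum
      obtain ⟨arcs', s1, s2, s3, s4⟩ := ih (m :: rest'.erase q).length
        (by simp only [List.length_cons]; omega) _ rfl
      simp only [List.length_cons, List.map_cons, List.sum_cons] at s1 s3 ⊢
      refine ⟨arcs', by omega, s2, by omega, fun v hv => s4 v ?_⟩
      have big : InteriorOfArc C [p, q] v → InteriorOfArc C (m :: rest'.erase q) v := by
        intro hh
        obtain ⟨o, ho, hk⟩ := m2 v hh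
        rw [List.mem_singleton] at ho
        exact ⟨o, by simp [ho], hk⟩
      obtain ⟨o, ho, hk⟩ := hv
      rcases List.mem_cons.1 ho with rfl | ho
      · exact big ⟨o, by simp, hk⟩
      · obtain ⟨o', ho', hk'⟩ := r4 v ⟨o, ho, hk⟩
        rcases List.mem_cons.1 (hperm.mem_iff.1 ho') with rfl | ho'
        · exact big ⟨o', by simp, hk'⟩
        · exact ⟨o', List.mem_cons_of_mem _ ho', hk'⟩

/-- The interiors of the given paths of the hole satisfy the requirements on `Q*` in the
definition of a contrivance, where the gap is `C (-L), …, C 0`. -/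
structure Catches {V : Type*} (G : SimpleGraph V) (n : ℤ) (C : ℤ → V) (L : ℤ) (x y : V)
    (arcs : List (ℤ × ℕ)) : Prop where
  gap : ∀ k, -L ≤ k → k ≤ 0 → G.Adj x (C k) ∨ G.Adj y (C k) → InteriorOfArc C arcs (C k)
  left : ∃ v, InteriorOfArc C arcs v ∧ G.Adj x v
  right : ∃ v, InteriorOfArc C arcs v ∧ G.Adj y v
  other : ∀ z, Major G n C z → ¬ G.Adj z x → ¬ G.Adj z y →
    ∃ v, InteriorOfArc C arcs v ∧ G.Adj z v

theorem Catches.mono {V : Type*} {G : SimpleGraph V} {n : ℤ} {C : ℤ → V} {L : ℤ} {x y : V}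
    {arcs arcs' : List (ℤ × ℕ)} (h : Catches G n C L x y arcs)
    (hsub : ∀ v, InteriorOfArc C arcs v → InteriorOfArc C arcs' v) :
    Catches G n C L x y arcs' where
  gap k h1 h2 h3 := hsub _ (h.gap k h1 h2 h3)
  left := let ⟨v, h1, h2⟩ := h.left; ⟨v, hsub v h1, h2⟩
  right := let ⟨v, h1, h2⟩ := h.right; ⟨v, hsub v h1, h2⟩
  other z h1 h2 h3 := let ⟨v, h4, h5⟩ := h.other z h1 h2 h3; ⟨v, hsub v h4, h5⟩

namespace ShortestHole

variable {V : Type*} {G : SimpleGraph V} {ℓ : ℕ} {n : ℤ} {C : ℤ → V}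

theorem exists_catches (h : ShortestHole G ℓ n C) {x : V} (hx : Major G n C x) {L : ℤ}
    (hL : 2 ≤ L) (h1 : G.Adj x (C (-L))) (h2 : G.Adj x (C 0))
    (h3 : ∀ k, -L < k → k < 0 → ¬ G.Adj x (C k))
    (hP : ∀ z, Major G n C z → ∃ k, -L ≤ k ∧ k ≤ 0 ∧ G.Adj z (C k)) :
    ∃ y arcs, Major G n C y ∧ Catches G n C L x y arcs ∧
      (arcs.map fun p => p.2 + 1).sum ≤ 4 * ℓ - 4 := by
  have hlong := h.long
  have hsix := h.six_le
  have hLn : L ≤ n - 3 := hx.gap_le (a := -L) (fun k hk hk' => h3 k hk (by omega))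
  have hit : ∀ (arcs : List (ℤ × ℕ)) (a : ℤ), (a, ℓ - 2) ∈ arcs → ∀ (z : V) (k : ℤ),
      G.Adj z (C k) → a + 1 ≤ k → k ≤ a + ℓ - 3 → ∃ v, InteriorOfArc C arcs v ∧ G.Adj z v :=
    fun arcs a ha z k hk hk1 hk2 =>
      ⟨C k, ⟨_, ha, k, by dsimp only; omega, by dsimp only; omega, rfl⟩, hk⟩
  have hxP : ∀ arcs : List (ℤ × ℕ), ((-ℓ + 4 : ℤ), ℓ - 2) ∈ arcs → (-L - 2, ℓ - 2) ∈ arcs →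
      ∀ k, -L ≤ k → k ≤ 0 → G.Adj x (C k) → InteriorOfArc C arcs (C k) := by
    intro arcs ha hb k hk hk' hadj
    have : k = -L ∨ k = 0 := by
      by_contra hne
      exact h3 k (by omega) (by omega) hadj
    rcases this with rfl | rfl
    · exact ⟨_, hb, -L, by dsimp only; omega, by dsimp only; omega, rfl⟩
    · exact ⟨_, ha, 0, by dsimp only; omega, by dsimp only; omega, rfl⟩
  have data : ∀ z, Major G n C z → ¬ G.Adj x z →
      (∀ k : ℤ, -ℓ + 5 ≤ k → k ≤ 1 → ¬ G.Adj z (C k)) →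
      (∀ k : ℤ, -L - 1 ≤ k → k ≤ -L + ℓ - 5 → ¬ G.Adj z (C k)) →
      ∃ t g g', ConsecutiveAdj G ℓ n C L z t g g' := by
    intro z hz hnxz hz1 hz2
    have hxz : x ≠ z := by
      rintro rfl
      exact hz1 0 (by omega) (by omega) h2
    obtain ⟨-, ⟨t, t1, t2, t3⟩, hfar⟩ := h.exists_consecutive_adj hx hz hxz hnxz (K := n - L) hL
      (by ring) h1 h2 h3 hz1 hz2 (hP z hz)
    obtain ⟨g, g1, g2, g3, g4⟩ := exists_least_int hfar
    obtain ⟨g', g1', g2', g3', g4'⟩ := exists_greatest_int hfar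
    refine ⟨t, g, g', hz, t1, t2, ?_, g1, ?_, g2', g3, g3', g4, g4'⟩
    · intro k hk hk'
      by_cases hmid : -L ≤ k ∧ k ≤ 0
      · exact t3 k hmid.1 hmid.2
      · refine iff_of_false ?_ (by omega)
        by_cases hk1 : k = 1
        · exact hz1 k (by omega) (by omega)
        · exact hz2 k (by omega) (by omega)
    · by_contra hlt
      exact g4 g' g1' (by omega) g3'
  by_cases hS : ∃ f y s f', ConsecutiveAdj G ℓ n C L y s f f'
  · obtain ⟨f, ⟨y, s, f', d⟩, hmax⟩ := Int.exists_greatest_of_bdd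
      (P := fun f => ∃ y s f', ConsecutiveAdj G ℓ n C L y s f f')
      ⟨n, by
        rintro g ⟨z, t, g', d⟩
        have := d.le
        have := d.last_le
        omega⟩ hS
    obtain ⟨y1, y2⟩ := d.adj_pair hsix
    have s1 := d.lower
    have s2 := d.upper
    refine ⟨y, [((-ℓ + 4 : ℤ), ℓ - 2), (-L - 2, ℓ - 2), (-s - 2, ℓ - 2), (f - ℓ + 4, ℓ - 2)], d.major,
      ⟨?_, ?_, ?_, ?_⟩, ?_⟩
    · rintro k hk hk' (hadj | hadj)
      · exact hxP _ (by simp) (by simp) k hk hk' hadj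
      · have := (d.adj_iff k (by omega) (by omega)).1 hadj
        exact ⟨(-s - 2, ℓ - 2), by simp, k, by dsimp only; omega, by dsimp only; omega, rfl⟩
    · exact hit _ (-ℓ + 4) (by simp) x 0 h2 (by omega) (by omega)
    · exact hit _ (-s - 2) (by simp) y _ y1 (by omega) (by omega)
    · intro z hz hzx hzy
      by_contra hcon
      have un : ∀ a : ℤ, (a, ℓ - 2) ∈ [((-ℓ + 4 : ℤ), ℓ - 2), (-L - 2, ℓ - 2), (-s - 2, ℓ - 2),
          (f - ℓ + 4, ℓ - 2)] → ∀ k, a + 1 ≤ k → k ≤ a + ℓ - 3 → ¬ G.Adj z (C k) :=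
        fun a ha k hk1 hk2 hk => hcon (hit _ a ha z k hk hk1 hk2)
      obtain ⟨t, g, g', d'⟩ := data z hz (fun hh => hzx hh.symm)
        (fun k hk hk' => un (-ℓ + 4) (by simp) k (by omega) (by omega))
        (fun k hk hk' => un (-L - 2) (by simp) k (by omega) (by omega))
      have hv := un (-s - 2) (by simp)
      refine d.hit h d' ?_ (fun hh => hzy hh.symm) (hmax g ⟨z, t, g', d'⟩)
        (fun k hk hk' => hv k (by omega) (by omega))
        (fun k hk hk' => un (f - ℓ + 4) (by simp) k (by omega) (by omega))
      rintro rfl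
      exact hv (-s) (by omega) (by omega) y1
    · simp; omega
  · refine ⟨x, [((-ℓ + 4 : ℤ), ℓ - 2), (-L - 2, ℓ - 2)], hx, ⟨?_, ?_, ?_, ?_⟩, ?_⟩
    · rintro k hk hk' (hadj | hadj) <;> exact hxP _ (by simp) (by simp) k hk hk' hadj
    · exact hit _ (-ℓ + 4) (by simp) x 0 h2 (by omega) (by omega)
    · exact hit _ (-ℓ + 4) (by simp) x 0 h2 (by omega) (by omega)
    · intro z hz hzx _
      by_contra hcon
      have un : ∀ a : ℤ, (a, ℓ - 2) ∈ [((-ℓ + 4 : ℤ), ℓ - 2), (-L - 2, ℓ - 2)] →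
          ∀ k, a + 1 ≤ k → k ≤ a + ℓ - 3 → ¬ G.Adj z (C k) :=
        fun a ha k hk1 hk2 hk => hcon (hit _ a ha z k hk hk1 hk2)
      obtain ⟨t, g, g', d'⟩ := data z hz (fun hh => hzx hh.symm)
        (fun k hk hk' => un (-ℓ + 4) (by simp) k (by omega) (by omega))
        (fun k hk hk' => un (-L - 2) (by simp) k (by omega) (by omega))
      exact hS ⟨g, z, t, g', d'⟩
    · simp; omega

/-- The paths in `exists_catches` may be taken pairwise anticomplete. -/
theorem exists_pairwise_catches (h : ShortestHole G ℓ n C) {x : V} (hx : Major G n C x) {L : ℤ}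
    (hL : 2 ≤ L) (h1 : G.Adj x (C (-L))) (h2 : G.Adj x (C 0))
    (h3 : ∀ k, -L < k → k < 0 → ¬ G.Adj x (C k))
    (hP : ∀ z, Major G n C z → ∃ k, -L ≤ k ∧ k ≤ 0 ∧ G.Adj z (C k)) :
    ∃ y arcs, Major G n C y ∧ Catches G n C L x y arcs ∧
      arcs.Pairwise (AnticompleteArcs G C) ∧ (∀ p ∈ arcs, ((p.2 : ℕ) : ℤ) ≤ n - 1) ∧
      (arcs.map fun p => p.2 + 1).sum ≤ 4 * ℓ - 4 := by
  have hlong := h.long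
  have hsix := h.six_le
  have hLn : L ≤ n - 3 := hx.gap_le (a := -L) (fun k hk hk' => h3 k hk (by omega))
  by_cases hn : n ≤ 4 * ℓ - 4
  · have hit : ∀ k, 3 ≤ k → k ≤ n → InteriorOfArc C [(2, (n - 1).toNat)] (C k) :=
      fun k hk hk' => ⟨_, List.mem_singleton_self _, k, by dsimp only; omega, by dsimp only; omega,
        rfl⟩
    have hmaj : ∀ z, Major G n C z → ∃ v, InteriorOfArc C [(2, (n - 1).toNat)] v ∧ G.Adj z v := by
      intro z hz
      obtain ⟨k, hk, hk', hadj⟩ := hz.2 1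
      exact ⟨C k, hit k (by omega) (by omega), hadj⟩
    refine ⟨x, [(2, (n - 1).toNat)], hx, ⟨?_, hmaj x hx, hmaj x hx, fun z hz _ _ => hmaj z hz⟩,
      List.pairwise_singleton _ _, ?_, ?_⟩
    · intro k hk hk' hadj
      have : k = -L ∨ k = 0 := by
        by_contra hne
        rcases hadj with hadj | hadj <;> exact h3 k (by omega) (by omega) hadj
      rw [← h.add_period]
      exact hit _ (by omega) (by omega)
    · intro p hp
      rw [List.mem_singleton] at hp
      subst hp
      dsimp only
      omega
    · simp; omega
  · obtain ⟨y, arcs, hy, hcat, hcost⟩ := h.exists_catches hx hL h1 h2 h3 hP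
    obtain ⟨arcs', -, q2, q3, q4⟩ := h.exists_pairwise_arcs arcs
    refine ⟨y, arcs', hy, hcat.mono q4, q2, fun p hp => ?_, q3.trans hcost⟩
    have := List.single_le_sum (l := arcs'.map fun p => p.2 + 1) (by simp) (p.2 + 1)
      (List.mem_map_of_mem (f := fun p : ℤ × ℕ => p.2 + 1) hp)
    omega

end ShortestHole

theorem listIdx_getElem {V : Type*} {l : List V} (hl : l.Nodup) {i : ℕ} (hi : i < l.length) :
    listIdx l l[i] = i := by
  rw [listIdx, List.findIdx_eq hi]
  refine ⟨by simp, fun j hj => ?_⟩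
  simp only [decide_eq_false_iff_not]
  exact fun h => hj.ne ((hl.getElem_inj_iff).1 h)

/-- Every path has a midpoint. -/
theorem exists_midpoint {V : Type*} {G : SimpleGraph V} {u v : V} {P : G.Walk u v}
    (hP : P.IsPath) :
    ∃ m ∈ P.support, listIdx P.support m ≤ listIdx P.support.reverse m + 1 ∧
      listIdx P.support.reverse m ≤ listIdx P.support m + 1 := by
  have hl : P.support.length = P.length + 1 := P.length_support
  have h1 : P.length / 2 < P.support.length := by omega
  have h2 : P.length - P.length / 2 < P.support.reverse.length := by
    rw [List.length_reverse]; omega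
  have e1 := listIdx_getElem hP.support_nodup h1
  have e2 := listIdx_getElem (List.nodup_reverse.2 hP.support_nodup) h2
  have e : P.support.reverse[P.length - P.length / 2] = P.support[P.length / 2] := by
    rw [List.getElem_reverse]
    congr 1
    omega
  rw [e] at e2
  refine ⟨_, List.getElem_mem h1, ?_, ?_⟩ <;> rw [e1, e2] <;> omega

theorem cMajor_iff_major {V : Type*} {G : SimpleGraph V} {u : V} {c : G.Walk u u} {C : ℤ → V}
    (hc : IsHole c) (hC : CyclicHole G c.length C) (hsup : ∀ x, x ∈ c.support ↔ ∃ k, C k = x)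
    (x : V) : CMajor G c x ↔ Major G c.length C x := by
  have hlen : (4 : ℤ) ≤ c.length := by exact_mod_cast hc.2.1
  have hmem : ∀ i, C i ∈ c.support := fun i => (hsup _).2 ⟨i, rfl⟩
  have hx : x ∉ c.support ↔ ∀ i, x ≠ C i := by
    rw [hsup, not_exists]
    exact forall_congr' fun i => ne_comm
  have hedge : ∀ i j, s(C i, C j) ∈ c.edges ↔ G.Adj (C i) (C j) := fun i j =>
    ⟨c.adj_of_mem_edges, hc.2.2 _ (hmem i) _ (hmem j)⟩
  refine and_congr hx ⟨fun h q => ?_, ?_⟩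
  · by_contra! hcon
    refine h ⟨C q, hmem q, fun z hz hadj => ?_⟩
    obtain ⟨j, rfl⟩ := (hsup z).1 hz
    have hr0 := Int.emod_nonneg (j - q) (show (c.length : ℤ) ≠ 0 by omega)
    have hr1 := Int.emod_lt_of_pos (j - q) (show (0 : ℤ) < c.length by omega)
    obtain ⟨r, hr⟩ : ∃ r, r = (j - q) % c.length := ⟨_, rfl⟩
    have e : C j = C (q + r) := by
      rw [hC.eq_iff, show j - (q + r) = (j - q) - r by ring, hr]
      exact Int.dvd_self_sub_emod
    rw [← hr] at hr0 hr1
    rw [e] at hadj ⊢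
    rw [hedge]
    by_cases h0 : r = 0
    · left; rw [h0, add_zero]
    · right
      by_cases h1 : r = 1
      · rw [h1]; exact hC.adj_succ q
      · by_cases h2 : r = c.length - 1
        · rw [hC.adj_iff]
          left
          exact ⟨-1, by rw [h2]; ring⟩
        · exact absurd hadj (hcon _ (by omega) (by omega))
  · rintro h ⟨q, hq, hall⟩
    obtain ⟨i, rfl⟩ := (hsup q).1 hq
    obtain ⟨k, h1, h2, hk⟩ := h i
    rcases hall _ (hmem k) hk with h' | h'
    · exact hC.ne_of_lt (i := i) (by omega) (by omega) h'.symm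
    · rw [hedge, hC.adj_of_lt' (by omega) (by omega)] at h'
      omega

theorem ShortestLEH.shortestHole {V : Type*} {G : SimpleGraph V} {ℓ : ℕ} (hℓ : 6 ≤ ℓ)
    (hℓeven : Even ℓ) (hG : Candidate G ℓ) {u : V} {c : G.Walk u u} (hc : ShortestLEH G ℓ c)
    {C : ℤ → V} (hC : CyclicHole G c.length C) : ShortestHole G ℓ c.length C := by
  obtain ⟨⟨⟨hshort, hjewel, htheta, -⟩, hprism⟩, ⟨⟨hhole, hlen, heven⟩, hmin⟩⟩ := hG, hc
  have hlong : ¬ c.length ≤ 2 * ℓ := fun h => hshort ⟨u, c, ⟨hhole, hlen, heven⟩, h⟩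
  have hℓeven' := Nat.even_iff.1 hℓeven
  have heven' := Nat.even_iff.1 heven
  exact { hC with
    six_le := hℓ
    even_bound := by omega
    even_length := by omega
    long := by omega
    shortest := fun v c' h1 h2 h3 => by
      have := hmin v c' ⟨h1, h2, Nat.even_iff.2 (by omega)⟩
      omega
    no_jewel := fun k hk h => hjewel ⟨k, hk, h⟩
    no_theta := htheta
    no_prism := hprism }

/-- A path of a hole, given by the positions of its vertices. -/
theorem CyclicHole.exists_path {V : Type*} {G : SimpleGraph V} {u : V} {c : G.Walk u u}
    {C : ℤ → V} (hC : CyclicHole G c.length C) (hedge : ∀ k, s(C k, C (k + 1)) ∈ c.edges)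
    (a : ℤ) (l : ℕ) (hl : (l : ℤ) ≤ c.length - 1) :
    ∃ W : G.Walk (C a) (C (a + l)), W.IsPath ∧ W.length = l ∧ (∀ e ∈ W.edges, e ∈ c.edges) ∧
      (∀ v, v ∈ W.support ↔ ∃ k, a ≤ k ∧ k ≤ a + l ∧ C k = v) ∧
      ∀ v, v ∈ inter W ↔ ∃ k, a < k ∧ k < a + l ∧ C k = v := by
  have hinj : ∀ i j : ℕ, i < j → j ≤ l → C (a + i) ≠ C (a + j) :=
    fun i j hij hj => hC.ne_of_lt (by omega) (by omega)
  have h0 : C (a + (0 : ℕ)) = C a := by simp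
  obtain ⟨W, h1, h2, h3, h4⟩ := exists_path_of_fun (G := G) (fun k : ℕ => C (a + k)) l h0 rfl
    (fun k hk => by
      have := hC.adj_succ (a + k)
      rwa [add_assoc] at this) hinj
  refine ⟨W, h1, h2, fun e he => ?_, fun v => ?_, fun v => ?_⟩
  · rw [h4, List.mem_map] at he
    obtain ⟨k, -, rfl⟩ := he
    have := hedge (a + k)
    rwa [add_assoc] at this
  · rw [mem_support_of_fun h3]
    constructor
    · rintro ⟨k, hk, rfl⟩
      exact ⟨a + k, by omega, by omega, rfl⟩
    · rintro ⟨k, hk, hk', rfl⟩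
      exact ⟨(k - a).toNat, by omega, by congr 1; omega⟩
  · rw [mem_inter_of_fun h0 rfl hinj h3]
    constructor
    · rintro ⟨k, hk, hk', rfl⟩
      exact ⟨a + k, by omega, by omega, rfl⟩
    · rintro ⟨k, hk, hk', rfl⟩
      exact ⟨(k - a).toNat, by omega, by omega, by congr 1; omega⟩

/-- If a major vertex has a gap, then some major vertex has a gap that every major vertex has a
neighbour in. -/
theorem exists_dominating_gap {V : Type*} {G : SimpleGraph V} {n : ℤ} {C : ℤ → V}
    (hC : CyclicHole G n C) {x₀ : V} {k₀ : ℤ} (hx₀ : Major G n C x₀)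
    (hk₀ : ¬ G.Adj x₀ (C k₀)) :
    ∃ x a L, Major G n C x ∧ 2 ≤ L ∧ G.Adj x (C a) ∧ G.Adj x (C (a + L)) ∧
      (∀ k, a < k → k < a + L → ¬ G.Adj x (C k)) ∧
      ∀ z, Major G n C z → ∃ k, a ≤ k ∧ k ≤ a + L ∧ G.Adj z (C k) := by
  have extend : ∀ z, Major G n C z → ∀ p q k, p ≤ q → q ≤ k → k ≤ p + n → G.Adj z (C k) →
      (∀ j, p ≤ j → j ≤ q → ¬ G.Adj z (C j)) →
      ∃ a b, a < p ∧ q < b ∧ G.Adj z (C a) ∧ G.Adj z (C b) ∧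
        ∀ j, a < j → j < b → ¬ G.Adj z (C j) := by
    intro z hz p q k hpq hqk hkp hk hno
    obtain ⟨b, hb1, hb2, hb3, hb4⟩ := exists_least_int (P := fun j => G.Adj z (C j)) (a := q)
      (b := k) ⟨k, hqk, le_rfl, hk⟩
    obtain ⟨a, ha1, ha2, ha3, ha4⟩ := exists_greatest_int (P := fun j => G.Adj z (C j))
      (a := k - n) (b := p) ⟨k - n, le_rfl, by omega, by rwa [hC.sub_period]⟩
    refine ⟨a, b, lt_of_le_of_ne ha2 ?_, lt_of_le_of_ne hb1 ?_, ha3, hb3, fun j h1 h2 => ?_⟩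
    · rintro rfl; exact hno _ le_rfl hpq ha3
    · rintro rfl; exact hno _ hpq le_rfl hb3
    · by_cases hp : j ≤ p
      · exact ha4 j h1 hp
      · by_cases hq : q ≤ j
        · exact hb4 j hq h2
        · exact hno j (by omega) (by omega)
  obtain ⟨L, ⟨x, a, hx, hL, h1, h2, h3⟩, hmax⟩ := Int.exists_greatest_of_bdd
    (P := fun L => ∃ x a, Major G n C x ∧ 2 ≤ L ∧ G.Adj x (C a) ∧ G.Adj x (C (a + L)) ∧
      ∀ k, a < k → k < a + L → ¬ G.Adj x (C k))
    ⟨n - 3, by rintro L ⟨x, a, hx, -, -, -, h⟩; exact hx.gap_le h⟩ (by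
      obtain ⟨k, hk1, hk2, hk⟩ := hx₀.2 k₀
      obtain ⟨a, b, ha, hb, h1, h2, h3⟩ := extend x₀ hx₀ k₀ k₀ k le_rfl (by omega) (by omega) hk
        (fun j hj hj' => by rwa [show j = k₀ by omega])
      exact ⟨b - a, x₀, a, hx₀, by omega, h1, by rwa [add_sub_cancel],
        by rwa [add_sub_cancel]⟩)
  refine ⟨x, a, L, hx, hL, h1, h2, h3, fun z hz => ?_⟩
  by_contra! hcon
  obtain ⟨k, hk1, hk2, hk⟩ := hz.2 a
  have hk3 : a + L ≤ k := by
    by_contra hlt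
    exact hcon k (by omega) (by omega) hk
  obtain ⟨a', b', ha, hb, h1', h2', h3'⟩ := extend z hz a (a + L) k (by omega) hk3 (by omega) hk hcon
  have := hmax (b' - a') ⟨z, a', hz, by omega, h1', by rwa [add_sub_cancel],
    by rwa [add_sub_cancel]⟩
  omega

end LEH

/-- if some `C`-major vertex has a `(C,x)`-gap, then there is a
`C`-contrivance of cost at most `4ℓ - 4`. -/
theorem exists_Ccontrivance {V : Type*} [Fintype V]
    (ℓ : ℕ) (hℓ : 6 ≤ ℓ) (hℓeven : Even ℓ)
    (G : SimpleGraph V) (hG : Candidate G ℓ)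
    {u : V} (c : G.Walk u u) (hc : ShortestLEH G ℓ c)
    (hgap : ∃ (x p₁ p₂ : V) (P : G.Walk p₁ p₂), CMajor G c x ∧ IsGap G c x P) :
    ∃ (x y p₁ p₂ m : V) (P : G.Walk p₁ p₂) (n : ℕ) (e₁ e₂ : Fin n → V)
      (W : ∀ t : Fin n, G.Walk (e₁ t) (e₂ t)),
      CMajor G c x ∧ CMajor G c y ∧
      IsGap G c x P ∧ m ∈ P.support ∧
      listIdx P.support m ≤ listIdx P.support.reverse m + 1 ∧
      listIdx P.support.reverse m ≤ listIdx P.support m + 1 ∧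
      (∀ z, CMajor G c z → ∃ v ∈ P.support, G.Adj z v) ∧
      (∀ t, (W t).IsPath) ∧
      (∀ t, ∀ e ∈ (W t).edges, e ∈ c.edges) ∧
      (∀ t s : Fin n, t ≠ s → Anticomplete G (vset (W t)) (vset (W s))) ∧
      (∀ v ∈ P.support, G.Adj x v ∨ G.Adj y v → v ∈ ⋃ t, inter (W t)) ∧
      (∃ t, ∃ w ∈ inter (W t), G.Adj x w) ∧
      (∃ t, ∃ w ∈ inter (W t), G.Adj y w) ∧
      (∀ z, CMajor G c z → ¬ G.Adj z x → ¬ G.Adj z y →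
        ∃ t, ∃ w ∈ inter (W t), G.Adj z w) ∧
      (∑ t, (W t).support.length) ≤ 4 * ℓ - 4 := by
  obtain ⟨C₀, hC₀, hsup₀, hedge₀⟩ := hc.1.1.exists_cyclicHole
  have hS₀ := hc.shortestHole hℓ hℓeven hG hC₀
  obtain ⟨x₀, q₁, q₂, Q, hx₀, hQ, hQc, hQ2, -, -, hQno⟩ := hgap
  obtain ⟨k₀, hk₀⟩ : ∃ k, C₀ k = Q.getVert 1 := by
    rw [← hsup₀]
    have hadj : Q.toSubgraph.Adj (Q.getVert 0) (Q.getVert 1) :=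
      Q.toSubgraph_adj_getVert (by omega)
    rw [← Subgraph.mem_edgeSet, Walk.mem_edges_toSubgraph] at hadj
    exact c.snd_mem_support_of_mem_edges (hQc _ hadj)
  have hno₀ : ¬ G.Adj x₀ (C₀ k₀) := by
    refine hQno _ ⟨hk₀ ▸ Q.getVert_mem_support 1, fun h => ?_, fun h => ?_⟩
    · rw [hk₀, hQ.getVert_eq_start_iff (by omega)] at h; omega
    · rw [hk₀, hQ.getVert_eq_end_iff (by omega)] at h; omega
  obtain ⟨x, a, L, hx, hL, h1, h2, h3, hP⟩ := exists_dominating_gap hC₀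
    ((cMajor_iff_major hc.1.1 hC₀ hsup₀ x₀).1 hx₀) hno₀
  obtain ⟨C, hCdef⟩ : ∃ C : ℤ → V, C = fun i => C₀ (i + (a + L)) := ⟨_, rfl⟩
  have hCC₀ : ∀ i, C i = C₀ (i + (a + L)) := fun i => by rw [hCdef]
  have hS : ShortestHole G ℓ c.length C := hCdef ▸ hS₀.shift (a + L)
  have hC := hS.toCyclicHole
  have hsup : ∀ z, z ∈ c.support ↔ ∃ k, C k = z := by
    intro z
    rw [hsup₀]
    constructor
    · rintro ⟨k, rfl⟩; exact ⟨k - (a + L), by rw [hCC₀, sub_add_cancel]⟩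
    · rintro ⟨k, rfl⟩; exact ⟨_, (hCC₀ k).symm⟩
  have hedge : ∀ k, s(C k, C (k + 1)) ∈ c.edges := by
    intro k
    rw [hCC₀, hCC₀, add_right_comm]
    exact hedge₀ _
  have hmaj₀ := cMajor_iff_major hc.1.1 hC₀ hsup₀
  have hmaj := cMajor_iff_major hc.1.1 hC hsup
  rw [← hmaj₀, hmaj] at hx
  have hLn : L ≤ c.length - 3 := hx.gap_le (a := -L) fun k hk hk' => by
    rw [hCC₀]; exact h3 _ (by omega) (by omega)
  replace h1 : G.Adj x (C (-L)) := by rw [hCC₀]; convert h1 using 2; ring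
  replace h2 : G.Adj x (C 0) := by rw [hCC₀]; convert h2 using 2; ring
  replace h3 : ∀ k, -L < k → k < 0 → ¬ G.Adj x (C k) := by
    intro k hk hk'
    rw [hCC₀]; exact h3 _ (by omega) (by omega)
  replace hP : ∀ z, Major G c.length C z → ∃ k, -L ≤ k ∧ k ≤ 0 ∧ G.Adj z (C k) := by
    intro z hz
    rw [← hmaj, hmaj₀] at hz
    obtain ⟨k, hk, hk', hadj⟩ := hP z hz
    exact ⟨k - (a + L), by omega, by omega, by rwa [hCC₀, sub_add_cancel]⟩
  obtain ⟨y, arcs, hy, hcat, hpair, hlen, hcost⟩ := hS.exists_pairwise_catches hx hL h1 h2 h3 hP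
  obtain ⟨P, hP1, hP2, hP3, hP4, hP5⟩ := hC.exists_path hedge (-L) L.toNat (by omega)
  obtain ⟨m, hm⟩ := exists_midpoint hP1
  have hLL : -L + (L.toNat : ℤ) = 0 := by omega
  choose W hW1 hW2 hW3 hW4 hW5 using fun t : Fin arcs.length =>
    hC.exists_path hedge (arcs.get t).1 (arcs.get t).2 (hlen _ (arcs.get_mem t))
  have hint : ∀ v, InteriorOfArc C arcs v → ∃ t, v ∈ inter (W t) := by
    rintro v ⟨p, hp, k, hk, hk', rfl⟩
    obtain ⟨t, rfl⟩ := List.get_of_mem hp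
    exact ⟨t, (hW5 t _).2 ⟨k, hk, hk', rfl⟩⟩
  have hcatch : ∀ z, (∃ v, InteriorOfArc C arcs v ∧ G.Adj z v) →
      ∃ t, ∃ w ∈ inter (W t), G.Adj z w := by
    rintro z ⟨v, hv, hadj⟩
    obtain ⟨t, ht⟩ := hint v hv
    exact ⟨t, v, ht, hadj⟩
  refine ⟨x, y, _, _, m, P, arcs.length, _, _, W, (hmaj x).2 hx, (hmaj y).2 hy,
    ⟨hP1, hP3, by omega, h1, hLL ▸ h2, fun z hz => ?_⟩, hm.1, hm.2.1, hm.2.2, fun z hz => ?_, hW1,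
    hW3, fun t s hts => ?_, fun v hv hadj => ?_, hcatch x hcat.left, hcatch y hcat.right,
    fun z hz hzx hzy => hcatch z (hcat.other z ((hmaj z).1 hz) hzx hzy), ?_⟩
  · obtain ⟨k, hk, hk', rfl⟩ := (hP5 z).1 hz
    exact h3 k hk (by omega)
  · obtain ⟨k, hk, hk', hadj⟩ := hP z ((hmaj z).1 hz)
    exact ⟨C k, (hP4 _).2 ⟨k, hk, by omega, rfl⟩, hadj⟩
  · have hts' : AnticompleteArcs G C (arcs.get t) (arcs.get s) := by
      rw [List.pairwise_iff_get] at hpair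
      rcases lt_or_gt_of_ne hts with hlt | hlt
      · exact hpair t s hlt
      · exact (hpair s t hlt).symm
    intro v hv w hw
    obtain ⟨k, hk, hk', rfl⟩ := (hW4 t v).1 hv
    obtain ⟨k', hk1, hk2, rfl⟩ := (hW4 s w).1 hw
    exact hts' k k' hk hk' hk1 hk2
  · obtain ⟨k, hk, hk', rfl⟩ := (hP4 v).1 hv
    exact Set.mem_iUnion.2 (hint _ (hcat.gap k hk (by omega) hadj))
  · refine le_trans (le_of_eq ?_) hcost
    rw [← Fin.sum_univ_fun_getElem]
    exact Finset.sum_congr rfl fun t _ => by rw [Walk.length_support, hW2]; rfl
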